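/- arXiv:1308.5560 — 2 statements merged into one kernel-verified Lean document; each statement's English description precedes it below -/
import Mathlib

section
/- Let R = ℝ[x₁,…,xₙ], fix m ≥ 1 and natural numbers α₁,…,α_m, and let Λ be a symmetric m×m matrix with entries in R that is homogeneous of some degree D and positive definite. Then there exists k ∈ ℕ such that every homogeneous vector in R^m of degree ≥ k lies in Σ(Λ); equivalently, the submodule R^m_{≥k} generated by all homogeneous vectors of degree ≥ k is contained in Σ(Λ). -/
open MvPolynomial

/-- `q` is a sum of squares of polynomials. -/
def IsSOS {n : ℕ} (q : MvPolynomial (Fin n) ℝ) : Prop :=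
  ∃ (s : ℕ) (g : Fin s → MvPolynomial (Fin n) ℝ), q = ∑ i, (g i) ^ 2

/-- A vector `v ∈ R^m` is homogeneous of degree `k` (for the twists `α₁,…,α_m`) if its
`i`-th coordinate is homogeneous of degree `k − αᵢ`, and zero whenever `k < αᵢ`. -/
def IsVHomog {n m : ℕ} (α : Fin m → ℕ) (k : ℕ)
    (v : Fin m → MvPolynomial (Fin n) ℝ) : Prop :=
  ∀ i, ((v i).IsHomogeneous (k - α i) ∧ (k < α i → v i = 0))

/-- A symmetric `m×m` matrix `Λ` over `R` is homogeneous of degree `D` (for the twists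
`α₁,…,α_m`) if its `(i,j)` entry is homogeneous of degree `D − αᵢ − αⱼ`, and zero
whenever `D < αᵢ + αⱼ`. -/
def IsMatHomog {n m : ℕ} (α : Fin m → ℕ) (D : ℕ)
    (Λ : Matrix (Fin m) (Fin m) (MvPolynomial (Fin n) ℝ)) : Prop :=
  ∀ i j, ((Λ i j).IsHomogeneous (D - α i - α j) ∧ (D < α i + α j → Λ i j = 0))

/-- `Σ(Λ)`: the `R`-submodule of `R^m` generated by all homogeneous vectors `v` such that
`q·Λ = v·vᵀ + w₁·w₁ᵀ + … + w_s·w_sᵀ` for some homogeneous sum of squares `q ∈ R` and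
vectors `w₁,…,w_s ∈ R^m`. -/
noncomputable def SigmaMod {n m : ℕ} (α : Fin m → ℕ)
    (Λ : Matrix (Fin m) (Fin m) (MvPolynomial (Fin n) ℝ)) :
    Submodule (MvPolynomial (Fin n) ℝ) (Fin m → MvPolynomial (Fin n) ℝ) :=
  Submodule.span _ {v | (∃ k, IsVHomog α k v) ∧
    ∃ (q : MvPolynomial (Fin n) ℝ) (dq : ℕ), IsSOS q ∧ q.IsHomogeneous dq ∧
      ∃ (s : ℕ) (w : Fin s → (Fin m → MvPolynomial (Fin n) ℝ)),
        q • Λ = Matrix.vecMulVec v v + ∑ l, Matrix.vecMulVec (w l) (w l)}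

theorem cast_descFactorial_eq_prod (a k : ℕ) :
    (a.descFactorial k : ℝ) = ∏ j ∈ Finset.range k, ((a : ℝ) - j) := by
  induction k with
  | zero => simp
  | succ k ih =>
    rw [Nat.descFactorial_succ, Finset.prod_range_succ, ← ih, mul_comm]
    rcases le_or_gt k a with h | h
    · push_cast [Nat.cast_sub h]; rfl
    · simp [Nat.descFactorial_eq_zero_iff_lt.2 h]

theorem prod_factorial_mul_coeff_sum_X_pow_mul_monomial {n : ℕ} (N : ℕ) (α β : Fin n →₀ ℕ)
    (hβ : β.degree = N + α.degree) (c : ℝ) :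
    (∏ i, ((β i).factorial : ℝ)) * coeff β ((∑ i, X i : MvPolynomial (Fin n) ℝ) ^ N *
      monomial α c) = N.factorial * (c * ∏ i, ((β i).descFactorial (α i) : ℝ)) := by
  rw [coeff_mul_monomial']
  split_ifs with h
  · have hdeg : (β - α).degree = N := by
      have : (β - α + α).degree = N + α.degree := by rw [tsub_add_cancel_of_le h, hβ]
      rw [map_add] at this
      omega
    have hsum : ((β - α).sum fun _ m ↦ m) = N := by
      rw [← hdeg]; rfl
    rw [coeff_sum_X_pow_of_fintype, if_pos hsum,
      Finsupp.multinomial_eq_of_support_subset (Finset.subset_univ _)]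
    have hspec := Nat.multinomial_spec (Finset.univ : Finset (Fin n)) ⇑(β - α)
    rw [← Finsupp.degree_eq_sum (β - α), hdeg] at hspec
    have hfac : (∏ i, ((β i).factorial : ℝ)) =
        (∏ i, (((β - α) i).factorial : ℝ)) * ∏ i, ((β i).descFactorial (α i) : ℝ) := by
      rw [← Finset.prod_mul_distrib]
      refine Finset.prod_congr rfl fun i _ ↦ ?_
      rw [Finsupp.tsub_apply, ← Nat.factorial_mul_descFactorial (h i)]
      push_cast
      ring
    rw [hfac, ← hspec]
    push_cast
    ring
  · obtain ⟨i, hi⟩ : ∃ i, β i < α i := by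
      by_contra! hcon
      exact h hcon
    have hz : ∏ i, ((β i).descFactorial (α i) : ℝ) = 0 :=
      Finset.prod_eq_zero (Finset.mem_univ i) (by simpa using hi)
    simp [hz]

/-- **Pólya's theorem**, with strictly positive coefficients. -/
theorem exists_forall_coeff_sum_X_pow_mul_pos {n e : ℕ} {g : MvPolynomial (Fin n) ℝ}
    (hg : g.IsHomogeneous e) (hpos : ∀ y : Fin n → ℝ, (∀ i, 0 ≤ y i) → y ≠ 0 → 0 < eval y g) :
    ∃ N : ℕ, ∀ β : Fin n →₀ ℕ, β.degree = N + e →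
      0 < coeff β ((∑ i, X i : MvPolynomial (Fin n) ℝ) ^ N * g) := by
  let G : ℝ × (Fin n → ℝ) → ℝ := fun z ↦
    ∑ a ∈ g.support, coeff a g * ∏ i, ∏ j ∈ Finset.range (a i), (z.2 i - j * z.1)
  have hG : Continuous G := by fun_prop
  have hG0 (y : Fin n → ℝ) : G (0, y) = eval y g := by
    simp [G, eval_eq']
  have hev : ∀ᶠ t in nhds (0 : ℝ), ∀ y ∈ stdSimplex ℝ (Fin n), 0 < G (t, y) := by
    refine (isCompact_stdSimplex ℝ (Fin n)).eventually_forall_of_forall_eventually fun y hy ↦ ?_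
    have h0 : 0 < G (0, y) := by
      rw [hG0]
      refine hpos y hy.1 ?_
      rintro rfl
      simpa using hy.2
    exact hG.continuousAt.eventually (lt_mem_nhds h0)
  have htend : Filter.Tendsto (fun N : ℕ ↦ ((N : ℝ) + 1)⁻¹) Filter.atTop (nhds 0) := by
    simpa using tendsto_one_div_add_atTop_nhds_zero_nat (𝕜 := ℝ)
  obtain ⟨K, hK⟩ := Filter.eventually_atTop.1 (htend.eventually hev)
  refine ⟨K + 1, fun β hβ ↦ ?_⟩
  set T : ℝ := ((K + e : ℕ) : ℝ) + 1 with hT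
  have hTpos : 0 < T := by positivity
  have hpow := hK (K + e) (by omega) (fun i ↦ β i / T) ⟨fun i ↦ by positivity, by
    rw [← Finset.sum_div, div_eq_one_iff_eq hTpos.ne', hT, ← Nat.cast_sum,
      ← Finsupp.degree_eq_sum, hβ]
    push_cast
    ring⟩
  have hcoeff : (∏ i, ((β i).factorial : ℝ)) *
      coeff β ((∑ i, X i : MvPolynomial (Fin n) ℝ) ^ (K + 1) * g) =
      (K + 1).factorial * (T ^ e * G (T⁻¹, fun i ↦ β i / T)) := by
    conv_lhs => rw [g.as_sum, Finset.mul_sum, coeff_sum, Finset.mul_sum]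
    rw [Finset.mul_sum, Finset.mul_sum]
    refine Finset.sum_congr rfl fun a ha ↦ ?_
    have hdeg : a.degree = e := by
      by_contra hne
      exact mem_support_iff.1 ha (hg.coeff_eq_zero hne)
    rw [prod_factorial_mul_coeff_sum_X_pow_mul_monomial _ _ _ (by rw [hβ, hdeg])]
    have hprod : ∏ i, ((β i).descFactorial (a i) : ℝ) =
        T ^ e * ∏ i, ∏ j ∈ Finset.range (a i), ((β i : ℝ) / T - j * T⁻¹) := by
      rw [← hdeg, Finsupp.degree_eq_sum, ← Finset.prod_pow_eq_pow_sum, ← Finset.prod_mul_distrib]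
      refine Finset.prod_congr rfl fun i _ ↦ ?_
      rw [cast_descFactorial_eq_prod]
      conv_rhs => rw [← Finset.card_range (a i), ← Finset.prod_const, Finset.card_range,
        ← Finset.prod_mul_distrib]
      refine Finset.prod_congr rfl fun j _ ↦ ?_
      field_simp
    rw [hprod]
    ring
  have hfac : 0 < ∏ i, ((β i).factorial : ℝ) :=
    Finset.prod_pos fun i _ ↦ by exact_mod_cast Nat.factorial_pos _
  refine pos_of_mul_pos_right ?_ hfac.le
  rw [hcoeff]
  have : 0 < G (T⁻¹, fun i ↦ β i / T) := hpow
  positivity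

theorem isSumSq_C {n : ℕ} {c : ℝ} (hc : 0 ≤ c) : IsSumSq (C c : MvPolynomial (Fin n) ℝ) := by
  rw [← Real.mul_self_sqrt hc, C_mul]
  exact IsSumSq.mul_self _

theorem isSumSq_X_pow {n : ℕ} (j : Fin n) (K : ℕ) :
    IsSumSq (X j ^ (2 * K) : MvPolynomial (Fin n) ℝ) := by
  rw [two_mul, pow_add]
  exact IsSumSq.mul_self _

/-- `q` is a form of degree `2 * K` such that, for every variable `X j`, some positive multiple of
`X j ^ (2 * K)` can be subtracted from `q` leaving a sum of squares. -/
structure IsStrictSOS {n : ℕ} (K : ℕ) (q : MvPolynomial (Fin n) ℝ) : Prop where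
  isHomogeneous : q.IsHomogeneous (2 * K)
  isSumSq : IsSumSq q
  exists_isSumSq_sub (j : Fin n) : ∃ ε : ℝ, 0 < ε ∧ IsSumSq (q - C ε * X j ^ (2 * K))

theorem IsStrictSOS.mul {n K L : ℕ} {p q : MvPolynomial (Fin n) ℝ} (hp : IsStrictSOS K p)
    (hq : IsStrictSOS L q) : IsStrictSOS (K + L) (p * q) where
  isHomogeneous := by
    rw [mul_add]
    exact hp.isHomogeneous.mul hq.isHomogeneous
  isSumSq := hp.isSumSq.mul hq.isSumSq
  exists_isSumSq_sub j := by
    obtain ⟨ε, hε, hpε⟩ := hp.exists_isSumSq_sub j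
    obtain ⟨δ, hδ, hqδ⟩ := hq.exists_isSumSq_sub j
    refine ⟨ε * δ, mul_pos hε hδ, ?_⟩
    have h : p * q - C (ε * δ) * X j ^ (2 * (K + L)) =
        (p - C ε * X j ^ (2 * K)) * q + C ε * X j ^ (2 * K) * (q - C δ * X j ^ (2 * L)) := by
      rw [C_mul, mul_add, pow_add]
      ring
    rw [h]
    exact (hpε.mul hq.isSumSq).add (((isSumSq_C hε.le).mul (isSumSq_X_pow j K)).mul hqδ)

theorem IsStrictSOS.add_isSumSq {n K : ℕ} {p q : MvPolynomial (Fin n) ℝ} (hp : IsStrictSOS K p)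
    (hq : IsSumSq q) (hq' : q.IsHomogeneous (2 * K)) : IsStrictSOS K (q + p) where
  isHomogeneous := hq'.add hp.isHomogeneous
  isSumSq := hq.add hp.isSumSq
  exists_isSumSq_sub j := by
    obtain ⟨ε, hε, hpε⟩ := hp.exists_isSumSq_sub j
    refine ⟨ε, hε, ?_⟩
    rw [add_sub_assoc]
    exact hq.add hpε

theorem isHomogeneous_expand {n e : ℕ} {g : MvPolynomial (Fin n) ℝ} (hg : g.IsHomogeneous e) :
    (expand 2 g).IsHomogeneous (2 * e) :=
  hg.aeval _ fun i ↦ isHomogeneous_X_pow i 2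

theorem isStrictSOS_expand {n e : ℕ} {g : MvPolynomial (Fin n) ℝ} (hg : g.IsHomogeneous e)
    (hpos : ∀ β : Fin n →₀ ℕ, β.degree = e → 0 < coeff β g) : IsStrictSOS e (expand 2 g) := by
  have hterm (β : Fin n →₀ ℕ) (c : ℝ) (hc : 0 ≤ c) : IsSumSq (expand 2 (monomial β c)) := by
    rw [expand_monomial, ← Real.mul_self_sqrt hc, two_smul, ← monomial_mul]
    exact IsSumSq.mul_self _
  have hcoeff (β : Fin n →₀ ℕ) (hβ : β ∈ g.support) : 0 < coeff β g := by
    refine hpos β ?_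
    by_contra hne
    exact mem_support_iff.1 hβ (hg.coeff_eq_zero hne)
  refine ⟨isHomogeneous_expand hg, ?_, fun j ↦ ?_⟩
  · rw [g.as_sum, map_sum]
    exact IsSumSq.sum fun β hβ ↦ hterm β _ (hcoeff β hβ).le
  · have hj : 0 < coeff (Finsupp.single j e) g := hpos _ (by simp)
    have hjs : Finsupp.single j e ∈ g.support := mem_support_iff.2 hj.ne'
    refine ⟨_, hj, ?_⟩
    have heq : expand 2 g - C (coeff (Finsupp.single j e) g) * X j ^ (2 * e) =
        ∑ β ∈ g.support.erase (Finsupp.single j e), expand 2 (monomial β (coeff β g)) := by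
      rw [sub_eq_iff_eq_add]
      conv_lhs => rw [g.as_sum, map_sum, ← Finset.sum_erase_add _ _ hjs]
      congr 1
      rw [expand_monomial, C_mul_X_pow_eq_monomial]
      simp
    rw [heq]
    exact IsSumSq.sum fun β hβ ↦ hterm β _ (hcoeff β (Finset.mem_of_mem_erase hβ)).le

/-- The substitution `X i ↦ -X i`. -/
noncomputable def flipSign {n : ℕ} (i : Fin n) :
    MvPolynomial (Fin n) ℝ →ₐ[ℝ] MvPolynomial (Fin n) ℝ :=
  aeval fun j ↦ if j = i then -X j else X j

theorem flipSign_X {n : ℕ} (i j : Fin n) : flipSign i (X j) = if j = i then -X j else X j :=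
  aeval_X _ _

theorem flipSign_flipSign {n : ℕ} (i : Fin n) (f : MvPolynomial (Fin n) ℝ) :
    flipSign i (flipSign i f) = f := by
  have h : (flipSign i).comp (flipSign i) = AlgHom.id ℝ _ := by
    ext1 j
    by_cases hj : j = i <;> simp [flipSign_X, hj]
  exact DFunLike.congr_fun h f

theorem flipSign_comm {n : ℕ} (i j : Fin n) (f : MvPolynomial (Fin n) ℝ) :
    flipSign i (flipSign j f) = flipSign j (flipSign i f) := by
  have h : (flipSign i).comp (flipSign j) = (flipSign j).comp (flipSign i) := by
    ext1 k
    by_cases hi : k = i <;> by_cases hj : k = j <;> simp [flipSign_X, hi, hj] <;>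
      split_ifs <;> simp_all [flipSign_X]
  exact DFunLike.congr_fun h f

theorem isHomogeneous_flipSign {n d : ℕ} (i : Fin n) {f : MvPolynomial (Fin n) ℝ}
    (hf : f.IsHomogeneous d) : (flipSign i f).IsHomogeneous d := by
  rw [← one_mul d]
  refine hf.aeval _ fun j ↦ ?_
  split_ifs
  · exact (isHomogeneous_X ℝ j).neg
  · exact isHomogeneous_X ℝ j

theorem eval_flipSign_pos {n : ℕ} (i : Fin n) {f : MvPolynomial (Fin n) ℝ}
    (hf : ∀ p : Fin n → ℝ, p ≠ 0 → 0 < eval p f) (p : Fin n → ℝ) (hp : p ≠ 0) :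
    0 < eval p (flipSign i f) := by
  have h : eval p (flipSign i f) = eval (fun j ↦ if j = i then -p j else p j) f := by
    have hcomp : (aeval p).comp (flipSign i) =
        (aeval fun j ↦ if j = i then -p j else p j : MvPolynomial (Fin n) ℝ →ₐ[ℝ] ℝ) := by
      ext1 j
      by_cases hj : j = i <;> simp [flipSign_X, hj]
    simpa [aeval_eq_eval] using DFunLike.congr_fun hcomp f
  rw [h]
  refine hf _ fun h0 ↦ hp ?_
  ext j
  have := congrFun h0 j
  by_cases hj : j = i <;> simpa [hj] using this

theorem coeff_flipSign {n : ℕ} (i : Fin n) (f : MvPolynomial (Fin n) ℝ) (β : Fin n →₀ ℕ) :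
    coeff β (flipSign i f) = (-1) ^ β i * coeff β f := by
  classical
  induction f using MvPolynomial.induction_on' with
  | monomial a c =>
    have h : flipSign i (monomial a c) = monomial a ((-1) ^ a i * c) := by
      have hX : (fun j ↦ if j = i then -X j else X j : Fin n → MvPolynomial (Fin n) ℝ) =
          fun j ↦ (if j = i then C (-1) else 1) * X j := by
        ext1 j
        split_ifs <;> simp
      rw [flipSign, hX, aeval_monomial, Finsupp.prod_fintype _ _ (by simp)]
      simp only [mul_pow, Finset.prod_mul_distrib, ite_pow, one_pow]
      rw [Finset.prod_ite_eq' , if_pos (Finset.mem_univ i), monomial_eq,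
        Finsupp.prod_fintype _ _ (by simp), C_mul, C_pow, algebraMap_eq]
      ring
    rw [h, coeff_monomial, coeff_monomial]
    split_ifs with hab
    · rw [hab]
    · simp
  | add p q hp hq => rw [map_add, coeff_add, coeff_add, hp, hq, mul_add]

theorem exists_expand_eq {n d : ℕ} {f : MvPolynomial (Fin n) ℝ} (hf : f.IsHomogeneous d)
    (h0 : f ≠ 0) (hflip : ∀ i, flipSign i f = f) :
    ∃ (e : ℕ) (g : MvPolynomial (Fin n) ℝ), d = 2 * e ∧ g.IsHomogeneous e ∧ expand 2 g = f := by
  have heven (β : Fin n →₀ ℕ) (hβ : β ∈ f.support) (i : Fin n) : Even (β i) := by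
    by_contra hodd
    have h := coeff_flipSign i f β
    rw [hflip, (Nat.not_even_iff_odd.1 hodd).neg_one_pow] at h
    exact mem_support_iff.1 hβ (by linarith)
  have hhalf (β : Fin n →₀ ℕ) (hβ : β ∈ f.support) :
      2 • β.mapRange (· / 2) (Nat.zero_div 2) = β := by
    ext i
    simpa using Nat.two_mul_div_two_of_even (heven β hβ i)
  have hdeg (β : Fin n →₀ ℕ) (hβ : β ∈ f.support) :
      2 * (β.mapRange (· / 2) (Nat.zero_div 2)).degree = d := by
    have h : β.degree = d := by
      by_contra hne
      exact mem_support_iff.1 hβ (hf.coeff_eq_zero hne)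
    rw [← h]
    conv_rhs => rw [← hhalf β hβ, map_nsmul, smul_eq_mul]
  obtain ⟨β₀, hβ₀⟩ := support_nonempty.2 h0
  refine ⟨_, ∑ β ∈ f.support, monomial (β.mapRange (· / 2) (Nat.zero_div 2)) (coeff β f),
    (hdeg β₀ hβ₀).symm, ?_, ?_⟩
  · refine IsHomogeneous.sum _ _ _ fun β hβ ↦ isHomogeneous_monomial _ ?_
    have := hdeg β hβ
    have := hdeg β₀ hβ₀
    omega
  · rw [map_sum]
    conv_rhs => rw [f.as_sum]
    refine Finset.sum_congr rfl fun β hβ ↦ ?_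
    rw [expand_monomial, hhalf β hβ]

theorem exists_isStrictSOS_mul_of_flipSign {n : ℕ} (hn : 0 < n) (S : Finset (Fin n)) {d : ℕ}
    {f : MvPolynomial (Fin n) ℝ} (hf : f.IsHomogeneous d)
    (hpos : ∀ p : Fin n → ℝ, p ≠ 0 → 0 < eval p f) (hflip : ∀ i ∉ S, flipSign i f = f) :
    ∃ (q : MvPolynomial (Fin n) ℝ) (K L : ℕ), 2 * L = 2 * K + d ∧
      IsStrictSOS K q ∧ IsStrictSOS L (q * f) := by
  induction S using Finset.induction_on generalizing d f with
  | empty =>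
    have h0 : f ≠ 0 := by
      rintro rfl
      have := hpos (fun _ ↦ 1) fun h ↦ one_ne_zero (congrFun h ⟨0, hn⟩)
      simp at this
    obtain ⟨e, g, rfl, hg, rfl⟩ := exists_expand_eq hf h0 (by simpa using hflip)
    have hgpos (y : Fin n → ℝ) (hy : ∀ i, 0 ≤ y i) (hy0 : y ≠ 0) : 0 < eval y g := by
      have h := hpos (fun i ↦ √(y i)) fun h ↦ hy0 <| by
        ext i
        exact (Real.sqrt_eq_zero (hy i)).1 (congrFun h i)
      rw [eval_expand] at h
      convert h using 3
      ext i
      simp [hy i]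
    obtain ⟨N, hN⟩ := exists_forall_coeff_sum_X_pow_mul_pos hg hgpos
    have hS : ((∑ i, X i : MvPolynomial (Fin n) ℝ) ^ N).IsHomogeneous N := by
      simpa using (IsHomogeneous.sum Finset.univ (fun i ↦ (X i : MvPolynomial (Fin n) ℝ)) 1
        fun i _ ↦ isHomogeneous_X ℝ i).pow N
    refine ⟨expand 2 ((∑ i, X i) ^ N), N, N + e, by ring, isStrictSOS_expand hS fun β hβ ↦ ?_, ?_⟩
    · have hsum : (β.sum fun _ m ↦ m) = N := hβ
      rw [coeff_sum_X_pow_of_fintype, if_pos hsum,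
        Finsupp.multinomial_eq_of_support_subset (Finset.subset_univ _)]
      exact_mod_cast Nat.multinomial_pos _ _
    · rw [← map_mul]
      exact isStrictSOS_expand (hS.mul hg) hN
  | insert i S hi ih =>
    have hf' := isHomogeneous_flipSign i hf
    have hpos' := eval_flipSign_pos i hpos
    have hinv (j : Fin n) (hj : j ∉ S) (hji : j ≠ i) : flipSign j f = f :=
      hflip j (by simp [hj, hji])
    obtain ⟨q, K, L, hKL, hq, hqf⟩ := ih (hf.add hf')
      (fun p hp ↦ by rw [map_add]; exact add_pos (hpos p hp) (hpos' p hp)) fun j hj ↦ by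
        by_cases hji : j = i
        · rw [hji, map_add, flipSign_flipSign, add_comm]
        · rw [map_add, flipSign_comm, hinv j hj hji]
    obtain ⟨r, K', L', hKL', hr, hrf⟩ := ih (hf.mul hf')
      (fun p hp ↦ by rw [map_mul]; exact mul_pos (hpos p hp) (hpos' p hp)) fun j hj ↦ by
        by_cases hji : j = i
        · rw [hji, map_mul, flipSign_flipSign, mul_comm]
        · rw [map_mul, flipSign_comm, hinv j hj hji]
    refine ⟨r * (q * (f + flipSign i f)), K' + L, K + L', by omega, hr.mul hqf, ?_⟩
    have h : r * (q * (f + flipSign i f)) * f =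
        r * q * (f * f) + q * (r * (f * flipSign i f)) := by ring
    rw [h]
    refine (hq.mul hrf).add_isSumSq ((hr.isSumSq.mul hq.isSumSq).mul (IsSumSq.mul_self f)) ?_
    convert (hr.isHomogeneous.mul hq.isHomogeneous).mul (hf.mul hf) using 1
    omega

/-- A positive definite form `f` has a strict sum of squares multiplier `q` such that `q * f` is
again a strict sum of squares. -/
theorem exists_isStrictSOS_mul {n : ℕ} (hn : 0 < n) {d : ℕ} {f : MvPolynomial (Fin n) ℝ}
    (hf : f.IsHomogeneous d) (hpos : ∀ p : Fin n → ℝ, p ≠ 0 → 0 < eval p f) :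
    ∃ (q : MvPolynomial (Fin n) ℝ) (K L : ℕ), 2 * L = 2 * K + d ∧
      IsStrictSOS K q ∧ IsStrictSOS L (q * f) :=
  exists_isStrictSOS_mul_of_flipSign hn Finset.univ hf hpos fun i hi ↦
    absurd (Finset.mem_univ i) hi

/-- The sums of matrices of the form `v * vᵀ`. -/
noncomputable def matrixSumSq (n m : ℕ) : AddSubmonoid (Matrix (Fin m) (Fin m) (MvPolynomial (Fin n) ℝ)) :=
  AddSubmonoid.closure (Set.range fun v ↦ Matrix.vecMulVec v v)

theorem vecMulVec_mem_matrixSumSq {n m : ℕ} (v : Fin m → MvPolynomial (Fin n) ℝ) :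
    Matrix.vecMulVec v v ∈ matrixSumSq n m :=
  AddSubmonoid.subset_closure ⟨v, rfl⟩

theorem exists_eq_sum_of_mem_matrixSumSq {n m : ℕ}
    {M : Matrix (Fin m) (Fin m) (MvPolynomial (Fin n) ℝ)} (hM : M ∈ matrixSumSq n m) :
    ∃ (s : ℕ) (w : Fin s → (Fin m → MvPolynomial (Fin n) ℝ)),
      M = ∑ l, Matrix.vecMulVec (w l) (w l) := by
  induction hM using AddSubmonoid.closure_induction with
  | mem M hM =>
    obtain ⟨v, rfl⟩ := hM
    exact ⟨1, fun _ ↦ v, by simp⟩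
  | zero => exact ⟨0, Fin.elim0, by simp⟩
  | add M N _ _ hM hN =>
    obtain ⟨s, w, rfl⟩ := hM
    obtain ⟨t, u, rfl⟩ := hN
    exact ⟨s + t, Fin.append w u, by simp [Fin.sum_univ_add]⟩

theorem smul_mem_matrixSumSq {n m : ℕ} {q : MvPolynomial (Fin n) ℝ} (hq : IsSumSq q)
    {M : Matrix (Fin m) (Fin m) (MvPolynomial (Fin n) ℝ)} (hM : M ∈ matrixSumSq n m) :
    q • M ∈ matrixSumSq n m := by
  induction hq with
  | zero => simp
  | sq_add a hs ih =>
    rw [add_smul]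
    refine add_mem ?_ ih
    clear ih
    induction hM using AddSubmonoid.closure_induction with
    | mem M hM =>
      obtain ⟨v, rfl⟩ := hM
      have h : (a * a) • Matrix.vecMulVec v v = Matrix.vecMulVec (a • v) (a • v) := by
        ext i j
        simp [Matrix.vecMulVec_apply]
        ring_nf
      change (a * a) • Matrix.vecMulVec v v ∈ _
      rw [h]
      exact vecMulVec_mem_matrixSumSq _
    | zero => simp
    | add M N _ _ hM hN =>
      rw [smul_add]
      exact add_mem hM hN

theorem IsSumSq.isSOS {n : ℕ} {q : MvPolynomial (Fin n) ℝ} (hq : IsSumSq q) : IsSOS q := by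
  induction hq with
  | zero => exact ⟨0, Fin.elim0, by simp⟩
  | sq_add a hs ih =>
    obtain ⟨s, g, rfl⟩ := ih
    exact ⟨s + 1, Fin.cons a g, by simp [Fin.sum_univ_succ, sq]⟩

/-- Insert a zero row and a zero column at position `p`. -/
noncomputable def padMatrix {n m : ℕ} (p : Fin (m + 1)) (M : Matrix (Fin m) (Fin m) (MvPolynomial (Fin n) ℝ)) :
    Matrix (Fin (m + 1)) (Fin (m + 1)) (MvPolynomial (Fin n) ℝ) :=
  Matrix.of (p.insertNth 0 fun i ↦ p.insertNth 0 (M i))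

section padMatrix

variable {n m : ℕ} (p : Fin (m + 1)) (M : Matrix (Fin m) (Fin m) (MvPolynomial (Fin n) ℝ))

@[simp] theorem padMatrix_apply_same_left (i : Fin (m + 1)) : padMatrix p M p i = 0 := by
  simp [padMatrix]

@[simp] theorem padMatrix_apply_same_right (i : Fin (m + 1)) : padMatrix p M i p = 0 := by
  cases i using p.succAboveCases <;> simp [padMatrix]

@[simp] theorem padMatrix_apply_succAbove (i j : Fin m) :
    padMatrix p M (p.succAbove i) (p.succAbove j) = M i j := by
  simp [padMatrix]

theorem padMatrix_mem_matrixSumSq {M : Matrix (Fin m) (Fin m) (MvPolynomial (Fin n) ℝ)}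
    (hM : M ∈ matrixSumSq n m) : padMatrix p M ∈ matrixSumSq n (m + 1) := by
  induction hM using AddSubmonoid.closure_induction with
  | mem M hM =>
    obtain ⟨v, rfl⟩ := hM
    convert vecMulVec_mem_matrixSumSq (p.insertNth (α := fun _ ↦ MvPolynomial (Fin n) ℝ) 0 v)
    ext1 i j
    cases i using p.succAboveCases <;> cases j using p.succAboveCases <;>
      simp [Matrix.vecMulVec_apply]
  | zero =>
    convert zero_mem (matrixSumSq n (m + 1))
    ext1 i j
    cases i using p.succAboveCases <;> cases j using p.succAboveCases <;> simp
  | add M N _ _ hM hN =>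
    convert add_mem hM hN
    ext1 i j
    cases i using p.succAboveCases <;> cases j using p.succAboveCases <;> simp

end padMatrix

/-- The Schur complement of the diagonal entry `(p, p)`, multiplied by that entry. -/
def scaledSchur {R : Type*} [CommRing R] {m : ℕ} (p : Fin (m + 1))
    (M : Matrix (Fin (m + 1)) (Fin (m + 1)) R) : Matrix (Fin m) (Fin m) R :=
  Matrix.of fun i j ↦ M p p * M (p.succAbove i) (p.succAbove j) -
    M p (p.succAbove i) * M p (p.succAbove j)

theorem sum_scaledSchur_pos {m : ℕ} (p : Fin (m + 1)) {M : Matrix (Fin (m + 1)) (Fin (m + 1)) ℝ}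
    (hsymm : M.IsSymm) (hM : ∀ y : Fin (m + 1) → ℝ, y ≠ 0 → 0 < ∑ i, ∑ j, y i * y j * M i j)
    (y : Fin m → ℝ) (hy : y ≠ 0) : 0 < ∑ i, ∑ j, y i * y j * scaledSchur p M i j := by
  have ha : 0 < M p p := by
    have h := hM (Pi.single p 1) (by simp)
    simpa [Pi.single_apply] using h
  set B := ∑ k, y k * M p (p.succAbove k) with hB
  have hx : p.insertNth (α := fun _ ↦ ℝ) (-B) (M p p • y) ≠ 0 := fun h ↦ hy <| by
    ext k
    have := congrFun h (p.succAbove k)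
    simpa [ha.ne'] using this
  have h := hM _ hx
  have hrow (k : Fin m) : M (p.succAbove k) p = M p (p.succAbove k) := hsymm.apply _ _
  have hBB : ∑ k, ∑ l, y k * y l * (M p (p.succAbove k) * M p (p.succAbove l)) = B * B := by
    rw [hB, Finset.sum_mul_sum]
    exact Finset.sum_congr rfl fun k _ ↦ Finset.sum_congr rfl fun l _ ↦ by ring
  have hB₁ : ∑ l, -B * (M p p * y l) * M p (p.succAbove l) = -B * M p p * B := by
    conv_rhs => rw [hB, Finset.mul_sum]
    exact Finset.sum_congr rfl fun l _ ↦ by ring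
  have hB₂ : ∑ l, M p p * y l * -B * M p (p.succAbove l) = -B * M p p * B := by
    rw [← hB₁]
    exact Finset.sum_congr rfl fun l _ ↦ by ring
  have hC : ∑ k, ∑ l, M p p * y k * (M p p * y l) * M (p.succAbove k) (p.succAbove l) =
      M p p * ∑ k, ∑ l, y k * y l * (M p p * M (p.succAbove k) (p.succAbove l)) := by
    simp only [Finset.mul_sum]
    exact Finset.sum_congr rfl fun k _ ↦ Finset.sum_congr rfl fun l _ ↦ by ring
  rw [Fin.sum_univ_succAbove _ p] at h
  simp only [Fin.sum_univ_succAbove _ p, Fin.insertNth_apply_same, Fin.insertNth_apply_succAbove,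
    Pi.smul_apply, smul_eq_mul, hrow, Finset.sum_add_distrib, hB₁, hB₂, hC] at h
  simp only [scaledSchur, Matrix.of_apply, mul_sub, Finset.sum_sub_distrib, hBB] at h ⊢
  refine pos_of_mul_pos_right (a := M p p) ?_ ha.le
  linarith

theorem IsStrictSOS.exists_isSumSq_C_mul_sub {n K : ℕ} {q : MvPolynomial (Fin n) ℝ}
    (hq : IsStrictSOS K q) (j : Fin n) :
    ∃ c : ℝ, 0 ≤ c ∧ IsSumSq (C c * q - X j ^ (2 * K)) := by
  obtain ⟨ε, hε, h⟩ := hq.exists_isSumSq_sub j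
  refine ⟨ε⁻¹, by positivity, ?_⟩
  have heq : C ε⁻¹ * q - X j ^ (2 * K) = C ε⁻¹ * (q - C ε * X j ^ (2 * K)) := by
    rw [mul_sub, ← mul_assoc, ← C_mul, inv_mul_cancel₀ hε.ne', C_1, one_mul]
  rw [heq]
  exact (isSumSq_C (inv_pos.2 hε).le).mul h

theorem exists_smul_sub_vecMulVec_mem_matrixSumSq {n m : ℕ} (j : Fin n) (i : Fin m) (d : Fin m → ℕ)
    {Λ : Matrix (Fin m) (Fin m) (MvPolynomial (Fin n) ℝ)} (hsymm : Λ.IsSymm)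
    (hΛ : ∀ k l, (Λ k l).IsHomogeneous (d k + d l))
    (hpos : ∀ x : Fin n → ℝ, x ≠ 0 → ∀ y : Fin m → ℝ, y ≠ 0 →
      0 < ∑ k, ∑ l, y k * y l * eval x (Λ k l)) :
    ∃ (q : MvPolynomial (Fin n) ℝ) (e N : ℕ), IsSumSq q ∧ q.IsHomogeneous e ∧
      q • Λ - Matrix.vecMulVec (Pi.single i (X j ^ N)) (Pi.single i (X j ^ N)) ∈
        matrixSumSq n m := by
  induction m with
  | zero => exact i.elim0
  | succ m ih =>
    have hdiag (p : Fin (m + 1)) (x : Fin n → ℝ) (hx : x ≠ 0) : 0 < eval x (Λ p p) := by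
      have h := hpos x hx (Pi.single p 1) (by simp)
      simpa [Pi.single_apply] using h
    rcases subsingleton_or_nontrivial (Fin (m + 1)) with hm | hm
    · obtain ⟨q, K, L, -, hq, hqf⟩ := exists_isStrictSOS_mul j.pos (hΛ i i) (hdiag i)
      obtain ⟨c, hc, hsq⟩ := hqf.exists_isSumSq_C_mul_sub j
      refine ⟨C c * q, 2 * K, L, (isSumSq_C hc).mul hq.isSumSq, hq.isHomogeneous.C_mul c, ?_⟩
      convert smul_mem_matrixSumSq hsq (vecMulVec_mem_matrixSumSq 1)
      ext1 k l
      rw [Subsingleton.elim k i, Subsingleton.elim l i]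
      simp [Matrix.vecMulVec_apply]
      ring
    · obtain ⟨p, hp⟩ := exists_ne i
      obtain ⟨i, rfl⟩ := Fin.exists_succAbove_eq hp.symm
      obtain ⟨q, K, L, -, hq, hqa⟩ := exists_isStrictSOS_mul j.pos (hΛ p p) (hdiag p)
      obtain ⟨c, hc, hsq⟩ := (hqa.mul hq).exists_isSumSq_C_mul_sub j
      have hschur : (scaledSchur p Λ).IsSymm := by
        ext1 k l
        simp only [scaledSchur, Matrix.transpose_apply, Matrix.of_apply]
        rw [hsymm.apply (p.succAbove k) (p.succAbove l), mul_comm (Λ p (p.succAbove l))]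
      obtain ⟨r, e, N, hr, hr', hrΛ⟩ := ih i (fun k ↦ d p + d (p.succAbove k)) hschur
        (fun k l ↦ by
          have h := (hΛ p p).mul (hΛ (p.succAbove k) (p.succAbove l))
          rw [add_add_add_comm] at h
          exact h.sub ((hΛ _ _).mul (hΛ _ _)))
        (fun x hx y hy ↦ by
          convert sum_scaledSchur_pos p (hsymm.map (eval x)) (hpos x hx) y hy
          simp [scaledSchur])
      have hcr : IsSumSq (C c * (q * Λ p p * q)) :=
        (isSumSq_C hc).mul (hqa.isSumSq.mul hq.isSumSq)
      have hmem := add_mem (smul_mem_matrixSumSq hcr hrΛ)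
        (smul_mem_matrixSumSq hsq (vecMulVec_mem_matrixSumSq (Pi.single i (X j ^ N))))
      refine ⟨C c * (q * Λ p p * (q * Λ p p)) * r, _, L + K + N,
        ((isSumSq_C hc).mul (IsSumSq.mul_self _)).mul hr,
        ((hqa.isHomogeneous.mul hqa.isHomogeneous).C_mul c).mul hr', ?_⟩
      convert add_mem (smul_mem_matrixSumSq (hcr.mul hr) (vecMulVec_mem_matrixSumSq (Λ p)))
        (padMatrix_mem_matrixSumSq p hmem)
      ext1 k l
      cases k using p.succAboveCases with
      | x =>
        simp [Matrix.vecMulVec_apply]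
        ring
      | p k =>
        cases l using p.succAboveCases with
        | x =>
          simp [Matrix.vecMulVec_apply, hsymm.apply p]
          ring
        | p l =>
          simp [Matrix.vecMulVec_apply, scaledSchur, Pi.single_apply]
          split_ifs <;> ring

theorem even_of_isHomogeneous_of_eval_pos {n d : ℕ} (hn : 0 < n) {f : MvPolynomial (Fin n) ℝ}
    (hf : f.IsHomogeneous d) (hpos : ∀ p : Fin n → ℝ, p ≠ 0 → 0 < eval p f) : Even d := by
  obtain ⟨q, K, L, h, -, -⟩ := exists_isStrictSOS_mul hn hf hpos
  exact ⟨L - K, by omega⟩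

theorem single_X_pow_mem_SigmaMod {n m : ℕ} (α : Fin m → ℕ) {D : ℕ}
    {Λ : Matrix (Fin m) (Fin m) (MvPolynomial (Fin n) ℝ)} (hsymm : Λ.IsSymm)
    (hΛ : IsMatHomog α D Λ) (hpd : ∀ p : Fin n → ℝ, p ≠ 0 → (Λ.map (eval p)).PosDef)
    (i : Fin m) (j : Fin n) :
    ∃ N : ℕ, Pi.single i (X j ^ N) ∈ SigmaMod α Λ := by
  have hpos (x : Fin n → ℝ) (hx : x ≠ 0) (y : Fin m → ℝ) (hy : y ≠ 0) :
      0 < ∑ k, ∑ l, y k * y l * eval x (Λ k l) := by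
    have h := (hpd x hx).dotProduct_mulVec_pos hy
    simp only [dotProduct, Matrix.mulVec, Finset.mul_sum] at h
    refine h.trans_eq (Finset.sum_congr rfl fun k _ ↦ Finset.sum_congr rfl fun l _ ↦ ?_)
    simp only [Pi.star_apply, star_trivial, Matrix.map_apply]
    ring
  have hdiag (k : Fin m) (x : Fin n → ℝ) (hx : x ≠ 0) : 0 < eval x (Λ k k) :=
    (hpd x hx).diag_pos
  have hle (k : Fin m) : α k + α k ≤ D := by
    by_contra! hlt
    have h := hdiag k (fun _ ↦ 1) fun h ↦ one_ne_zero (congrFun h j)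
    simp [(hΛ k k).2 hlt] at h
  have hev (k : Fin m) : Even (D - α k - α k) :=
    even_of_isHomogeneous_of_eval_pos j.pos (hΛ k k).1 (hdiag k)
  obtain ⟨q, e, N, hq, hqe, hmem⟩ := exists_smul_sub_vecMulVec_mem_matrixSumSq j i
    (fun k ↦ (D - α k - α k) / 2) hsymm (fun k l ↦ by
      convert (hΛ k l).1 using 1
      obtain ⟨a, ha⟩ := hev k
      obtain ⟨b, hb⟩ := hev l
      have := hle k
      have := hle l
      omega) hpos
  obtain ⟨s, w, hw⟩ := exists_eq_sum_of_mem_matrixSumSq hmem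
  refine ⟨N, Submodule.subset_span ⟨⟨N + α i, fun k ↦ ?_⟩, q, e, hq.isSOS, hqe, s, w, ?_⟩⟩
  · by_cases hk : k = i
    · subst hk
      simpa using isHomogeneous_X_pow (R := ℝ) j N
    · simp [hk, isHomogeneous_zero]
  · rw [← hw, add_sub_cancel]

theorem single_mem_of_isHomogeneous {n m N k : ℕ}
    (P : Submodule (MvPolynomial (Fin n) ℝ) (Fin m → MvPolynomial (Fin n) ℝ)) (i : Fin m)
    (hP : ∀ j, Pi.single i (X j ^ N) ∈ P) (hk : n * N < k) {f : MvPolynomial (Fin n) ℝ}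
    (hf : f.IsHomogeneous k) : Pi.single i f ∈ P := by
  rw [f.as_sum, ← LinearMap.coe_single (MvPolynomial (Fin n) ℝ), map_sum]
  refine sum_mem fun β hβ ↦ ?_
  have hdeg : β.degree = k := by
    by_contra hne
    exact mem_support_iff.1 hβ (hf.coeff_eq_zero hne)
  obtain ⟨j, hj⟩ : ∃ j, N ≤ β j := by
    by_contra! hlt
    have h : β.degree ≤ n * N := by
      rw [Finsupp.degree_eq_sum]
      simpa using Finset.sum_le_card_nsmul Finset.univ β N fun j _ ↦ (hlt j).le
    omega
  have h : monomial β (coeff β f) = monomial (β - Finsupp.single j N) (coeff β f) * X j ^ N := by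
    rw [X_pow_eq_monomial, monomial_mul, mul_one, tsub_add_cancel_of_le (by simpa using hj)]
  rw [h, ← smul_eq_mul, map_smul]
  exact P.smul_mem _ (hP j)

/-- **Corollary.** Let `Λ` be a symmetric homogeneous `m×m` matrix over `R = ℝ[x₁,…,xₙ]`
which is positive definite. Then there is a `k` such that the submodule `R^m_{≥k}` of
`R^m` generated by all homogeneous vectors of degree `≥ k` is contained in `Σ(Λ)`. -/
theorem statement15 {n m : ℕ} (hm : 1 ≤ m) (α : Fin m → ℕ) (D : ℕ)
    (Λ : Matrix (Fin m) (Fin m) (MvPolynomial (Fin n) ℝ)) (hsymm : Λ.IsSymm)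
    (hΛ : IsMatHomog α D Λ)
    (hpd : ∀ p : Fin n → ℝ, p ≠ 0 → (Λ.map (eval p)).PosDef) :
    ∃ k : ℕ, Submodule.span (MvPolynomial (Fin n) ℝ)
        {v : Fin m → MvPolynomial (Fin n) ℝ | ∃ k', k ≤ k' ∧ IsVHomog α k' v} ≤
      SigmaMod α Λ := by
  choose N hN using single_X_pow_mem_SigmaMod α hsymm hΛ hpd
  set N₀ := ∑ i, ∑ j, N i j with hN₀
  refine ⟨n * N₀ + 1 + ∑ i, α i, Submodule.span_le.2 ?_⟩
  rintro v ⟨k, hk, hv⟩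
  rw [← Finset.univ_sum_single v]
  refine sum_mem fun i _ ↦ single_mem_of_isHomogeneous (N := N₀) _ i (fun j ↦ ?_) ?_ (hv i).1
  · have hle : N i j ≤ N₀ :=
      (Finset.single_le_sum (f := N i) (fun _ _ ↦ Nat.zero_le _) (Finset.mem_univ j)).trans
        (Finset.single_le_sum (f := fun i ↦ ∑ j, N i j) (fun _ _ ↦ Nat.zero_le _)
          (Finset.mem_univ i))
    rw [← Nat.sub_add_cancel hle, pow_add, ← smul_eq_mul, Pi.single_smul]
    exact Submodule.smul_mem _ _ (hN i j)
  · have := Finset.single_le_sum (f := α) (fun _ _ ↦ Nat.zero_le _) (Finset.mem_univ i)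
    omega
end

section
/- Let R = ℝ[x₁,…,xₙ], fix m ≥ 1 and natural numbers α₁,…,α_m, and let Λ be a symmetric m×m matrix with entries in R that is homogeneous of some degree D and positive definite. Then there exist k ∈ ℕ, a polynomial q ∈ R that is a sum of squares in R, and vectors v₁,…,v_r ∈ R^m, each homogeneous of degree k, such that q·Λ = v₁·v₁ᵀ + … + v_r·v_rᵀ (as matrices over R) and v₁,…,v_r generate the R-submodule R^m_{≥k} of R^m. -/
open MvPolynomial

/-! ### Homogeneous polynomials as combinations of words -/

/-- A homogeneous polynomial of degree `card T` is a combination of products of variables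
indexed by words `T → σ`. -/
lemma MvPolynomial.IsHomogeneous.mem_span_prod_X {σ T : Type*} [Fintype T]
    {p : MvPolynomial σ ℝ} (hp : p.IsHomogeneous (Fintype.card T)) :
    p ∈ Submodule.span ℝ (Set.range fun w : T → σ ↦ ∏ t, (X (w t) : MvPolynomial σ ℝ)) := by
  rw [← mem_homogeneousSubmodule, ← homogeneousSubmodule_one_pow,
    homogeneousSubmodule_one_eq_span_X, Submodule.span_pow] at hp
  refine Submodule.span_mono ?_ hp
  intro a ha
  obtain ⟨f, rfl⟩ := Set.mem_pow.1 ha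
  choose g hg using fun i ↦ (f i).2
  refine ⟨fun t ↦ g (Fintype.equivFin T t), ?_⟩
  simp only [List.prod_ofFn, hg]
  exact Equiv.prod_comp (Fintype.equivFin T) fun i ↦ (f i : MvPolynomial σ ℝ)

/-- Coefficients of a homogeneous polynomial with respect to words of length `card T`. -/
lemma MvPolynomial.IsHomogeneous.exists_word_coeff {σ T : Type*} [Fintype σ] [Fintype T]
    [DecidableEq T] {p : MvPolynomial σ ℝ} (hp : p.IsHomogeneous (Fintype.card T)) :
    ∃ c : (T → σ) → ℝ, p = ∑ w, C (c w) * ∏ t, X (w t) := by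
  obtain ⟨c, hc⟩ := (Submodule.mem_span_range_iff_exists_fun ℝ).1 hp.mem_span_prod_X
  exact ⟨c, by simp [← hc, smul_eq_C_mul]⟩

/-- Summing over all words extending a given subword. -/
lemma sum_prod_mul_comp_embedding {A L T S : Type*} [CommRing A] [Fintype L] [Fintype T]
    [DecidableEq T] [Fintype S] [DecidableEq S] (y : L → A) (c : (S → L) → A) {σ : S → T}
    (hσ : Function.Injective σ) :
    ∑ w : T → L, (∏ t, y (w t)) * c (w ∘ σ) =
      (∑ l, y l) ^ (Fintype.card T - Fintype.card S) * ∑ u : S → L, (∏ s, y (u s)) * c u := by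
  classical
  let e : S ⊕ {t // t ∉ Set.range σ} ≃ T :=
    (Equiv.sumCongr (Equiv.ofInjective σ hσ) (Equiv.refl _)).trans (Equiv.sumCompl (· ∈ Set.range σ))
  have he : ∀ s, e (Sum.inl s) = σ s := fun s ↦ rfl
  have hcard : Fintype.card T - Fintype.card S = Fintype.card {t // t ∉ Set.range σ} := by
    rw [← Fintype.card_congr e, Fintype.card_sum]; simp
  let E : (T → L) ≃ (S → L) × ({t // t ∉ Set.range σ} → L) :=
    (Equiv.arrowCongr e.symm (Equiv.refl L)).trans (Equiv.sumArrowEquivProdArrow _ _ _)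
  let g : (S → L) × ({t // t ∉ Set.range σ} → L) → A :=
    fun q ↦ ((∏ s, y (q.1 s)) * c q.1) * ∏ r, y (q.2 r)
  have h1 : ∀ w : T → L, (∏ t, y (w t)) * c (w ∘ σ) = g (E w) := by
    intro w
    have h2 : (E w).1 = w ∘ σ := rfl
    rw [← Equiv.prod_comp e, Fintype.prod_sum_type]
    simp only [g, h2, he]
    have h3 : ∀ r, (E w).2 r = w (e (Sum.inr r)) := fun r ↦ rfl
    simp only [h3, Function.comp]
    ring
  rw [Finset.sum_congr rfl fun w _ ↦ h1 w, Equiv.sum_comp E g, Fintype.sum_prod_type]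
  simp only [g]
  simp_rw [← Finset.mul_sum]
  rw [← Finset.sum_mul, hcard, mul_comm]
  congr 1
  rw [← Fintype.prod_sum, Finset.prod_const, Finset.card_univ]

/-! ### A sampling version of Pólya's theorem -/

lemma exists_descFactorial_gap (d : ℕ) {ε C : ℝ} (hε : 0 < ε) :
    ∃ N₀ : ℕ, ∀ N ≥ N₀, 1 ≤ N ∧ ((N : ℝ) ^ d - N.descFactorial d) * C < ε * N ^ d := by
  have h := (isEquivalent_descFactorial d).isLittleO.def
    (c := ε / (2 * (|C| + 1))) (by positivity)
  obtain ⟨N₀, hN₀⟩ := Filter.eventually_atTop.1 h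
  refine ⟨max N₀ 1, fun N hN ↦ ⟨le_of_max_le_right hN, ?_⟩⟩
  have hN1 : (1 : ℝ) ≤ N := by exact_mod_cast le_of_max_le_right hN
  have h1 := hN₀ N (le_of_max_le_left hN)
  have hpow : (0 : ℝ) < (N : ℝ) ^ d := by positivity
  simp only [Pi.sub_apply, Real.norm_eq_abs, abs_of_pos hpow] at h1
  calc ((N : ℝ) ^ d - N.descFactorial d) * C
      ≤ |((N : ℝ) ^ d - N.descFactorial d) * C| := le_abs_self _
    _ = |(N.descFactorial d : ℝ) - N ^ d| * |C| := by rw [abs_mul, abs_sub_comm]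
    _ ≤ ε / (2 * (|C| + 1)) * N ^ d * |C| := by gcongr
    _ = ε * N ^ d * (|C| / (2 * (|C| + 1))) := by ring
    _ < ε * N ^ d * 1 := by
      have : |C| / (2 * (|C| + 1)) < 1 := by
        rw [div_lt_one (by positivity)]
        linarith [abs_nonneg C]
      gcongr
    _ = ε * N ^ d := mul_one _

lemma card_filter_injective (d N : ℕ) :
    (Finset.univ.filter (Function.Injective : (Fin d → Fin N) → Prop)).card =
      N.descFactorial d := by
  classical
  rw [← Fintype.card_subtype,
    Fintype.card_congr (Equiv.subtypeInjectiveEquivEmbedding (Fin d) (Fin N)),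
    Fintype.card_embedding_eq]
  simp

/-- If a form with word coefficients `q` is at least `ε * s` on the simplex, and all the
coefficients are at most `C * s` in absolute value, then for long words `w` the sum of the
coefficients over all subwords of `w` is positive. -/
lemma exists_sum_subwords_pos (d : ℕ) {ε C : ℝ} (hε : 0 < ε) :
    ∃ N₀ : ℕ, ∀ N ≥ N₀, ∀ {L : Type} [Fintype L] (q : (Fin d → L) → ℝ) (s : ℝ), 0 < s →
      (∀ u, |q u| ≤ C * s) →
      (∀ y ∈ stdSimplex ℝ L, ε * s ≤ ∑ u : Fin d → L, (∏ i, y (u i)) * q u) →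
      ∀ w : Fin N → L,
        0 < ∑ σ ∈ Finset.univ.filter (Function.Injective : (Fin d → Fin N) → Prop), q (w ∘ σ) := by
  classical
  obtain ⟨N₀, hN₀⟩ := exists_descFactorial_gap d (C := C) hε
  refine ⟨N₀, fun N hN L _ q s hs hC hq w ↦ ?_⟩
  obtain ⟨hN1, hgap⟩ := hN₀ N hN
  have hNpos : (0 : ℝ) < N := by exact_mod_cast hN1
  let y : L → ℝ := fun l ↦ ∑ t : Fin N, if w t = l then (N : ℝ)⁻¹ else 0
  have hy : y ∈ stdSimplex ℝ L := by
    refine ⟨fun l ↦ Finset.sum_nonneg fun t _ ↦ by split_ifs <;> positivity, ?_⟩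
    simp only [y]
    rw [Finset.sum_comm]
    simp [hNpos.ne']
  have hall : ∑ u : Fin d → L, (∏ i, y (u i)) * q u =
      ((N : ℝ)⁻¹) ^ d * ∑ σ : Fin d → Fin N, q (w ∘ σ) := by
    simp only [y, Fintype.prod_sum, Finset.sum_mul]
    rw [Finset.sum_comm, Finset.mul_sum]
    refine Finset.sum_congr rfl fun σ _ ↦ ?_
    rw [Finset.sum_eq_single (w ∘ σ)]
    · simp
    · intro u _ hu
      obtain ⟨i, hi⟩ := Function.ne_iff.1 hu
      rw [Finset.prod_eq_zero (Finset.mem_univ i), zero_mul]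
      exact if_neg fun h ↦ hi h.symm
    · simp
  have h1 := hq y hy
  rw [hall, inv_pow, inv_mul_eq_div, le_div_iff₀ (by positivity)] at h1
  have h2 := Finset.sum_filter_add_sum_filter_not Finset.univ
    (Function.Injective : (Fin d → Fin N) → Prop) fun σ ↦ q (w ∘ σ)
  have h3 : ∑ σ ∈ Finset.univ.filter (fun σ : Fin d → Fin N ↦ ¬ Function.Injective σ),
      q (w ∘ σ) ≤ ((N : ℝ) ^ d - N.descFactorial d) * (C * s) := by
    refine (Finset.sum_le_card_nsmul _ _ (C * s) fun σ _ ↦ (le_abs_self _).trans (hC _)).trans ?_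
    have h4 := Finset.card_filter_add_card_filter_not (s := Finset.univ)
      (Function.Injective : (Fin d → Fin N) → Prop)
    rw [card_filter_injective, Finset.card_univ, Fintype.card_fun, Fintype.card_fin,
      Fintype.card_fin] at h4
    have h5 : (N : ℝ) ^ d = N.descFactorial d +
      (Finset.univ.filter (fun σ : Fin d → Fin N ↦ ¬ Function.Injective σ)).card := by
      exact_mod_cast h4.symm
    rw [nsmul_eq_mul, h5]
    simp
  nlinarith

/-! ### Squares of linear forms and the lift of a form of even degree -/

/-- The linear form `xᵢ ± xⱼ`. -/
noncomputable def pairForm {n : ℕ} (l : Fin n × Fin n × Bool) : MvPolynomial (Fin n) ℝ :=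
  X l.1 + (if l.2.2 then X l.2.1 else -X l.2.1)

/-- Substitution of the squares of the linear forms `xᵢ ± xⱼ`. -/
noncomputable def squareSubst (n : ℕ) :
    MvPolynomial (Fin n × Fin n × Bool) ℝ →ₐ[ℝ] MvPolynomial (Fin n) ℝ :=
  aeval fun l ↦ pairForm l ^ 2

/-- The linear form which becomes `xᵢ * xⱼ` under `squareSubst`. -/
noncomputable def polarForm {n : ℕ} (i j : Fin n) : MvPolynomial (Fin n × Fin n × Bool) ℝ :=
  C (1 / 4) * (X (i, j, true) - X (i, j, false))

lemma isHomogeneous_pairForm {n : ℕ} (l : Fin n × Fin n × Bool) :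
    (pairForm l).IsHomogeneous 1 := by
  unfold pairForm
  split_ifs
  · exact (isHomogeneous_X _ _).add (isHomogeneous_X _ _)
  · exact (isHomogeneous_X _ _).add (isHomogeneous_X _ _).neg

lemma isHomogeneous_polarForm {n : ℕ} (i j : Fin n) : (polarForm i j).IsHomogeneous 1 := by
  simpa [polarForm] using
    (isHomogeneous_C _ (1 / 4 : ℝ)).mul ((isHomogeneous_X ℝ (i, j, true)).sub
      (isHomogeneous_X ℝ (i, j, false)))

lemma squareSubst_polarForm {n : ℕ} (i j : Fin n) :
    squareSubst n (polarForm i j) = X i * X j := by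
  have h : (C (1 / 4) : MvPolynomial (Fin n) ℝ) * 4 = 1 := by
    rw [show (4 : MvPolynomial (Fin n) ℝ) = C 4 from (map_ofNat C 4).symm, ← C_mul]
    norm_num
  simp only [squareSubst, polarForm, map_mul, map_sub, aeval_X, algHom_C, algebraMap_eq, pairForm,
    if_true, Bool.false_eq_true, if_false]
  linear_combination (X i * X j : MvPolynomial (Fin n) ℝ) * h

lemma sum_pairForm_sq (n : ℕ) :
    ∑ l, pairForm l ^ 2 = C (4 * n : ℝ) * ∑ i : Fin n, (X i * X i : MvPolynomial (Fin n) ℝ) := by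
  have h : ∀ i j : Fin n, (X i + X j : MvPolynomial (Fin n) ℝ) ^ 2 + (X i + -X j) ^ 2 =
      2 * (X i * X i) + 2 * (X j * X j) := fun i j ↦ by ring
  simp only [Fintype.sum_prod_type, Fintype.sum_bool, pairForm, if_true, Bool.false_eq_true,
    if_false, h, Finset.sum_add_distrib, Finset.sum_const, Finset.card_univ, Fintype.card_fin,
    ← Finset.mul_sum, nsmul_eq_mul, C_mul, map_natCast, map_ofNat]
  ring

/-- A form of degree `2 * K` is a form of degree `K` in the products `xᵢ * xⱼ`. -/
lemma exists_aeval_mul_of_isHomogeneous {σ : Type*} [Fintype σ] {K : ℕ}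
    {f : MvPolynomial σ ℝ} (hf : f.IsHomogeneous (2 * K)) :
    ∃ P : MvPolynomial (σ × σ) ℝ, P.IsHomogeneous K ∧
      aeval (fun ij : σ × σ ↦ (X ij.1 * X ij.2 : MvPolynomial σ ℝ)) P = f := by
  have hcard : Fintype.card (Fin K × Fin 2) = 2 * K := by simp [mul_comm]
  obtain ⟨c, hc⟩ := (hcard ▸ hf : f.IsHomogeneous _).exists_word_coeff
  refine ⟨∑ w : Fin K × Fin 2 → σ, C (c w) * ∏ t : Fin K, X (w (t, 0), w (t, 1)), ?_, ?_⟩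
  · refine IsHomogeneous.sum _ _ _ fun w _ ↦ ?_
    simpa using (isHomogeneous_C _ (c w)).mul
      (IsHomogeneous.prod Finset.univ _ (fun _ ↦ 1) fun (t : Fin K) _ ↦
        isHomogeneous_X ℝ (w (t, 0), w (t, 1)))
  · conv_rhs => rw [hc]
    simp [map_sum, map_prod, Fintype.prod_prod_type, algebraMap_eq]

/-- A form of degree four which vanishes at `y` in the simplex only if `y` comes from a point. -/
noncomputable def rankOneForm (n : ℕ) : MvPolynomial (Fin n × Fin n × Bool) ℝ :=
  (∑ l, X l) ^ 2 * (∑ l, X l - C (4 * n : ℝ) * ∑ i, polarForm i i) ^ 2 +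
    ∑ i, ∑ j, ∑ k, (polarForm i j * polarForm k k - polarForm i k * polarForm j k) ^ 2

lemma isHomogeneous_sum_X {σ : Type*} [Fintype σ] :
    (∑ l, X l : MvPolynomial σ ℝ).IsHomogeneous 1 :=
  IsHomogeneous.sum _ _ _ fun l _ ↦ isHomogeneous_X ℝ l

lemma isHomogeneous_rankOneForm (n : ℕ) : (rankOneForm n).IsHomogeneous 4 := by
  have h1 : (∑ i : Fin n, polarForm i i).IsHomogeneous 1 :=
    IsHomogeneous.sum _ _ _ fun i _ ↦ isHomogeneous_polarForm i i
  have h2 := (isHomogeneous_C (Fin n × Fin n × Bool) (4 * n : ℝ)).mul h1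
  rw [zero_add] at h2
  refine ((isHomogeneous_sum_X.pow 2).mul ((isHomogeneous_sum_X.sub h2).pow 2)).add ?_
  refine IsHomogeneous.sum _ _ _ fun i _ ↦ IsHomogeneous.sum _ _ _ fun j _ ↦
    IsHomogeneous.sum _ _ _ fun k _ ↦ ?_
  exact ((((isHomogeneous_polarForm i j).mul (isHomogeneous_polarForm k k)).sub
    ((isHomogeneous_polarForm i k).mul (isHomogeneous_polarForm j k))).pow 2)

lemma squareSubst_sum_X (n : ℕ) : squareSubst n (∑ l, X l) = ∑ l, pairForm l ^ 2 := by
  simp [squareSubst]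

lemma squareSubst_rankOneForm (n : ℕ) : squareSubst n (rankOneForm n) = 0 := by
  have h : ∀ i j k : Fin n, (X i * X j * (X k * X k) - X i * X k * (X j * X k) :
      MvPolynomial (Fin n) ℝ) = 0 := fun i j k ↦ by ring
  simp only [rankOneForm, map_add, map_mul, map_pow, map_sub, squareSubst_sum_X, algHom_C,
    algebraMap_eq, sum_pairForm_sq]
  simp only [map_sum, map_pow, map_sub, map_mul, squareSubst_polarForm, h]
  simp

lemma eval_rankOneForm_nonneg {n : ℕ} (y : Fin n × Fin n × Bool → ℝ) :
    0 ≤ eval y (rankOneForm n) := by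
  simp only [rankOneForm, map_add, map_mul, map_sum, map_pow]
  positivity

lemma exists_eq_mul_of_eval_rankOneForm_eq_zero {n : ℕ} {y : Fin n × Fin n × Bool → ℝ}
    (hy : ∑ l, y l = 1) (h : eval y (rankOneForm n) = 0) :
    ∃ x : Fin n → ℝ, x ≠ 0 ∧ ∀ i j, eval y (polarForm i j) = x i * x j := by
  simp only [rankOneForm, map_add, map_mul, map_sum, map_pow, map_sub, eval_X, eval_C, hy] at h
  set z : Fin n → Fin n → ℝ := fun i j ↦ eval y (polarForm i j) with hz
  change 1 ^ 2 * (1 - 4 * n * ∑ i, z i i) ^ 2 +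
    ∑ i, ∑ j, ∑ k, (z i j * z k k - z i k * z j k) ^ 2 = 0 at h
  have hnn : 0 ≤ ∑ i, ∑ j, ∑ k, (z i j * z k k - z i k * z j k) ^ 2 := by positivity
  have h1 : (1 - 4 * n * ∑ i, z i i) ^ 2 = 0 := by nlinarith [sq_nonneg (1 - 4 * n * ∑ i, z i i)]
  have h2 : ∑ i, ∑ j, ∑ k, (z i j * z k k - z i k * z j k) ^ 2 = 0 := by linarith
  have h3 : ∀ i j k, z i j * z k k = z i k * z j k := by
    intro i j k
    rw [Finset.sum_eq_zero_iff_of_nonneg fun i _ ↦ by positivity] at h2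
    have h4 := h2 i (Finset.mem_univ i)
    rw [Finset.sum_eq_zero_iff_of_nonneg fun i _ ↦ by positivity] at h4
    have h5 := h4 j (Finset.mem_univ j)
    rw [Finset.sum_eq_zero_iff_of_nonneg fun i _ ↦ by positivity] at h5
    exact sub_eq_zero.1 (pow_eq_zero_iff two_ne_zero |>.1 (h5 k (Finset.mem_univ k)))
  have htr : 4 * (n : ℝ) * ∑ i, z i i = 1 := by
    linarith [pow_eq_zero_iff two_ne_zero |>.1 h1]
  obtain ⟨k, -, hk⟩ : ∃ k ∈ Finset.univ, 0 < z k k := by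
    apply Finset.exists_lt_of_sum_lt
    rw [Finset.sum_const_zero]
    by_contra hneg
    nlinarith [mul_nonneg (Nat.cast_nonneg n : (0 : ℝ) ≤ n) (neg_nonneg.2 (not_lt.1 hneg))]
  refine ⟨fun i ↦ z i k / √(z k k), fun h0 ↦ ?_, fun i j ↦ ?_⟩
  · have := congrFun h0 k
    simp only [Pi.zero_apply, div_eq_zero_iff] at this
    rcases this with h | h
    · exact hk.ne' h
    · exact (Real.sqrt_pos.2 hk).ne' h
  · rw [div_mul_div_comm, Real.mul_self_sqrt hk.le, ← h3, mul_div_assoc, div_self hk.ne', mul_one]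

/-! ### Positive lifts -/

lemma IsCompact.exists_add_mul_ge {Y : Type*} [TopologicalSpace Y] {K : Set Y} (hK : IsCompact K)
    {g R : Y → ℝ} (hg : ContinuousOn g K) (hR : ContinuousOn R K) (hR0 : ∀ y ∈ K, 0 ≤ R y)
    (hpos : ∀ y ∈ K, R y = 0 → 0 < g y) :
    ∃ c ε : ℝ, 0 < ε ∧ ∀ y ∈ K, ε ≤ g y + c * R y := by
  suffices h : ∃ c : ℝ, ∀ y ∈ K, 0 < g y + c * R y by
    obtain ⟨c, hc⟩ := h
    obtain ⟨ε, hε, h⟩ := hK.exists_forall_le' (hg.add (hR.const_smul c)) hc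
    exact ⟨c, ε, hε, h⟩
  obtain ⟨G, hG⟩ := (hK.image_of_continuousOn hg).bddBelow
  have hG' : ∀ y ∈ K, G ≤ g y := fun y hy ↦ hG (Set.mem_image_of_mem g hy)
  have hK' : IsCompact (K ∩ g ⁻¹' Set.Iic 0) := by
    obtain ⟨t, ht, h⟩ := continuousOn_iff_isClosed.1 hg _ isClosed_Iic
    rw [Set.inter_comm, h, Set.inter_comm]
    exact hK.inter_right ht
  obtain ⟨ρ, hρ, h⟩ := hK'.exists_forall_le' (hR.mono Set.inter_subset_left) (a := 0)
    fun y hy ↦ (hR0 y hy.1).lt_of_ne fun h0 ↦ (hpos y hy.1 h0.symm).not_ge hy.2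
  refine ⟨(|G| + 1) / ρ, fun y hy ↦ ?_⟩
  by_cases hgy : 0 < g y
  · have := hR0 y hy
    positivity
  · have h1 := h y ⟨hy, not_lt.1 hgy⟩
    have h2 : |G| + 1 ≤ (|G| + 1) / ρ * R y := by
      rw [div_mul_eq_mul_div, le_div_iff₀ hρ]
      gcongr
    linarith [hG' y hy, neg_abs_le G]

/-- A positive definite matrix of forms of degree `2 * K` lifts, up to a factor, to a matrix of
forms in the variables of `squareSubst` that is positive definite on the simplex. -/
lemma exists_posDef_lift {n K : ℕ} {J : Type*} [Fintype J] [DecidableEq J]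
    (M : Matrix J J (MvPolynomial (Fin n) ℝ)) (hsymm : M.IsSymm)
    (hM : ∀ a b, (M a b).IsHomogeneous (2 * K))
    (hpos : ∀ p : Fin n → ℝ, p ≠ 0 → (M.map (eval p)).PosDef) :
    ∃ F : Matrix J J (MvPolynomial (Fin n × Fin n × Bool) ℝ),
      F.IsSymm ∧ (∀ a b, (F a b).IsHomogeneous (K + 4)) ∧
      (∀ a b, squareSubst n (F a b) = (∑ l, pairForm l ^ 2) ^ 4 * M a b) ∧
      ∃ ε : ℝ, 0 < ε ∧ ∀ y ∈ stdSimplex ℝ (Fin n × Fin n × Bool), ∀ u : J → ℝ,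
        ε * (∑ a, u a ^ 2) ≤ ∑ a, ∑ b, u a * u b * eval y (F a b) := by
  have hlift : ∀ f : MvPolynomial (Fin n) ℝ, ∃ P : MvPolynomial (Fin n × Fin n) ℝ,
      f.IsHomogeneous (2 * K) → P.IsHomogeneous K ∧
        aeval (fun ij ↦ (X ij.1 * X ij.2 : MvPolynomial (Fin n) ℝ)) P = f := fun f ↦ by
    by_cases hf : f.IsHomogeneous (2 * K)
    · obtain ⟨P, hP⟩ := exists_aeval_mul_of_isHomogeneous hf
      exact ⟨P, fun _ ↦ hP⟩
    · exact ⟨0, fun h ↦ (hf h).elim⟩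
  choose P hP using hlift
  let F₀ : J → J → MvPolynomial (Fin n × Fin n × Bool) ℝ := fun a b ↦
    aeval (fun ij : Fin n × Fin n ↦ polarForm ij.1 ij.2) (P (M a b))
  have hF₀hom : ∀ a b, (F₀ a b).IsHomogeneous K := by
    intro a b
    have := ((hP (M a b) (hM a b)).1).aeval (fun ij : Fin n × Fin n ↦ polarForm ij.1 ij.2)
      (n := 1) (fun ij ↦ isHomogeneous_polarForm ij.1 ij.2)
    rwa [one_mul] at this
  have hF₀subst : ∀ a b, squareSubst n (F₀ a b) = M a b := by
    intro a b
    rw [← AlgHom.comp_apply, comp_aeval]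
    simp only [squareSubst_polarForm]
    exact (hP (M a b) (hM a b)).2
  have hF₀eval : ∀ (y : Fin n × Fin n × Bool → ℝ) (x : Fin n → ℝ),
      (∀ i j, eval y (polarForm i j) = x i * x j) → ∀ a b,
      eval y (F₀ a b) = eval x (M a b) := by
    intro y x hyx a b
    conv_rhs => rw [← (hP (M a b) (hM a b)).2]
    simp only [F₀, ← coe_aeval_eq_eval, RingHom.coe_coe] at hyx ⊢
    rw [← AlgHom.comp_apply, ← AlgHom.comp_apply, comp_aeval, comp_aeval]
    simp [hyx]
  have hK : IsCompact (stdSimplex ℝ (Fin n × Fin n × Bool) ×ˢ {u : J → ℝ | ∑ a, u a ^ 2 = 1}) := by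
    refine (isCompact_stdSimplex ℝ _).prod ?_
    refine (isCompact_univ_pi fun _ : J ↦ isCompact_Icc (a := (-1 : ℝ)) (b := 1)).of_isClosed_subset
      (isClosed_eq (by fun_prop) continuous_const) fun u (hu : ∑ a, u a ^ 2 = 1) ↦ ?_
    intro a _
    have : u a ^ 2 ≤ 1 := hu ▸ Finset.single_le_sum (f := fun a ↦ u a ^ 2)
      (fun b _ ↦ sq_nonneg _) (Finset.mem_univ a)
    exact abs_le.1 (sq_le_one_iff_abs_le_one _ |>.1 this)
  have hcont : ∀ Q : MvPolynomial (Fin n × Fin n × Bool) ℝ,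
      Continuous fun q : (Fin n × Fin n × Bool → ℝ) × (J → ℝ) ↦ eval q.1 Q :=
    fun Q ↦ (MvPolynomial.continuous_eval Q).comp continuous_fst
  obtain ⟨c, ε, hε, hc⟩ := hK.exists_add_mul_ge
    (g := fun q ↦ ∑ a, ∑ b, q.2 a * q.2 b * eval q.1 (F₀ a b))
    (R := fun q ↦ eval q.1 (rankOneForm n))
    (Continuous.continuousOn <| continuous_finsetSum _ fun a _ ↦ continuous_finsetSum _ fun b _ ↦
      Continuous.mul (by fun_prop) (hcont _))
    (hcont _).continuousOn (fun q _ ↦ eval_rankOneForm_nonneg q.1) (by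
      rintro ⟨y, u⟩ ⟨hy, hu⟩ hR
      obtain ⟨x, hx, hyx⟩ := exists_eq_mul_of_eval_rankOneForm_eq_zero hy.2 hR
      have hu0 : u ≠ 0 := by
        rintro rfl
        simp at hu
      have := (hpos x hx).dotProduct_mulVec_pos hu0
      simp only [hF₀eval y x hyx]
      simpa [dotProduct, Matrix.mulVec, Finset.mul_sum, mul_assoc, mul_comm, mul_left_comm]
        using this)
  let F : Matrix J J (MvPolynomial (Fin n × Fin n × Bool) ℝ) := fun a b ↦
    (∑ l, X l) ^ 4 * F₀ a b + if a = b then C c * (∑ l, X l) ^ K * rankOneForm n else 0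
  have hS := isHomogeneous_sum_X (σ := Fin n × Fin n × Bool)
  refine ⟨F, ?_, fun a b ↦ ?_, fun a b ↦ ?_, ε, hε, fun y hy u ↦ ?_⟩
  · refine Matrix.IsSymm.ext fun a b ↦ ?_
    simp only [F, F₀, hsymm.apply a b, eq_comm (a := a)]
  · refine IsHomogeneous.add ?_ ?_
    · simpa [add_comm] using (hS.pow 4).mul (hF₀hom a b)
    · split_ifs
      · simpa using ((isHomogeneous_C _ c).mul (hS.pow K)).mul (isHomogeneous_rankOneForm n)
      · exact isHomogeneous_zero _ _ _
  · have : squareSubst n (if a = b then C c * (∑ l, X l) ^ K * rankOneForm n else 0) = 0 := by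
      split_ifs <;> simp [squareSubst_rankOneForm]
    simp only [F, map_add, this, map_mul, map_pow, squareSubst_sum_X, hF₀subst, add_zero]
  · have hsum : eval y (∑ l, X l) = 1 := by simpa using hy.2
    have hFeval : ∀ a b, eval y (F a b) =
        eval y (F₀ a b) + if a = b then c * eval y (rankOneForm n) else 0 := by
      intro a b
      simp only [F, map_add, map_mul, map_pow, hsum]
      split_ifs <;> simp [hsum]
    have hquad : ∑ a, ∑ b, u a * u b * eval y (F a b) =
        (∑ a, ∑ b, u a * u b * eval y (F₀ a b)) +
          c * eval y (rankOneForm n) * ∑ a, u a ^ 2 := by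
      simp only [hFeval, mul_add, Finset.sum_add_distrib, mul_ite, mul_zero, Finset.sum_ite_eq,
        Finset.mem_univ, if_true, Finset.mul_sum]
      congr 1
      exact Finset.sum_congr rfl fun a _ ↦ by ring
    rw [hquad]
    have hnn : 0 ≤ ∑ a, u a ^ 2 := by positivity
    rcases hnn.eq_or_lt with h0 | h0
    · have hu : ∀ a, u a = 0 := fun a ↦ by
        have := (Finset.sum_eq_zero_iff_of_nonneg fun a _ ↦ sq_nonneg (u a)).1 h0.symm a
          (Finset.mem_univ a)
        exact pow_eq_zero_iff two_ne_zero |>.1 this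
      simp [hu]
    · set s := ∑ a, u a ^ 2 with hs
      have hss : √s ^ 2 = s := Real.sq_sqrt hnn
      have h1 := hc (y, fun a ↦ u a / √s) ⟨hy, by
        simp only [Set.mem_ofPred_eq, div_pow, hss, ← Finset.sum_div]
        exact div_self h0.ne'⟩
      have h2 : ∑ a, ∑ b, u a / √s * (u b / √s) * eval y (F₀ a b) =
          (∑ a, ∑ b, u a * u b * eval y (F₀ a b)) / s := by
        simp only [Finset.sum_div]
        refine Finset.sum_congr rfl fun a _ ↦ Finset.sum_congr rfl fun b _ ↦ ?_
        rw [div_mul_div_comm, ← sq, hss]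
        ring
      simp only [h2] at h1
      have h3 := mul_le_mul_of_nonneg_right h1 hnn
      rw [add_mul, div_mul_cancel₀ _ h0.ne'] at h3
      exact h3

/-! ### Decomposition of matrices of forms of constant even degree -/

lemma sum_sum_sum_comm {A B T M : Type*} [AddCommMonoid M] (r : Finset A) (s : Finset B)
    (t : Finset T) (f : A → B → T → M) :
    ∑ c ∈ t, ∑ a ∈ r, ∑ b ∈ s, f a b c = ∑ a ∈ r, ∑ b ∈ s, ∑ c ∈ t, f a b c := by
  rw [Finset.sum_comm]
  exact Finset.sum_congr rfl fun a _ ↦ Finset.sum_comm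

/-- Up to a square factor, a positive definite matrix of forms is a combination of squares of
products of linear forms with positive definite coefficients. -/
lemma exists_posDef_word_coeff {n K : ℕ} {J : Type*} [Fintype J] [DecidableEq J]
    (M : Matrix J J (MvPolynomial (Fin n) ℝ)) (hsymm : M.IsSymm)
    (hM : ∀ a b, (M a b).IsHomogeneous (2 * K))
    (hpos : ∀ p : Fin n → ℝ, p ≠ 0 → (M.map (eval p)).PosDef) :
    ∃ (N : ℕ) (t : MvPolynomial (Fin n) ℝ) (A : (Fin N → Fin n × Fin n × Bool) → Matrix J J ℝ),
      (∀ w, (A w).PosDef) ∧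
      ∀ a b, t ^ 2 * M a b = ∑ w, (∏ i, pairForm (w i)) ^ 2 * C (A w a b) := by
  classical
  obtain ⟨F, hFsymm, hFhom, hFsubst, ε, hε, hF⟩ := exists_posDef_lift M hsymm hM hpos
  have hword : ∀ P : MvPolynomial (Fin n × Fin n × Bool) ℝ,
      ∃ c : (Fin (K + 4) → Fin n × Fin n × Bool) → ℝ,
        P.IsHomogeneous (K + 4) → P = ∑ w, C (c w) * ∏ t, X (w t) := fun P ↦ by
    by_cases hP : P.IsHomogeneous (K + 4)
    · obtain ⟨c, hc⟩ := (by simpa using hP :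
        P.IsHomogeneous (Fintype.card (Fin (K + 4)))).exists_word_coeff
      exact ⟨c, fun _ ↦ hc⟩
    · exact ⟨0, fun h ↦ (hP h).elim⟩
  choose c hc using hword
  let B : ℝ := ∑ a, ∑ b, ∑ w, |c (F a b) w|
  obtain ⟨N₀, hN₀⟩ := exists_sum_subwords_pos (K + 4) hε (C := B)
  let T := N₀ + 4
  let N := K + 2 * T
  let inj := Finset.univ.filter (Function.Injective : (Fin (K + 4) → Fin N) → Prop)
  let A : (Fin N → Fin n × Fin n × Bool) → Matrix J J ℝ :=
    fun w a b ↦ ∑ σ ∈ inj, c (F a b) (w ∘ σ)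
  refine ⟨N, C √(N.descFactorial (K + 4)) * (∑ l, pairForm l ^ 2) ^ T, A, fun w ↦ ?_,
    fun a b ↦ ?_⟩
  · refine .of_dotProduct_mulVec_pos ?_ fun u hu ↦ ?_
    · refine Matrix.IsHermitian.ext fun a b ↦ ?_
      simp [A, hFsymm.apply]
    · have hs : 0 < ∑ a, u a ^ 2 := by
        obtain ⟨a, ha⟩ := Function.ne_iff.1 hu
        exact Finset.sum_pos' (fun b _ ↦ sq_nonneg _) ⟨a, Finset.mem_univ a, by
          have : u a ≠ 0 := ha
          positivity⟩
      have h := hN₀ N (by grind) (fun v ↦ ∑ a, ∑ b, u a * u b * c (F a b) v) (∑ a, u a ^ 2) hs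
        (fun v ↦ ?_) (fun y hy ↦ ?_) w
      · refine h.trans_eq ?_
        rw [sum_sum_sum_comm]
        simp only [A, dotProduct, Matrix.mulVec, Finset.mul_sum, Finset.sum_mul, Pi.star_apply,
          star_trivial]
        exact Finset.sum_congr rfl fun a _ ↦ Finset.sum_congr rfl fun b _ ↦
          Finset.sum_congr rfl fun σ _ ↦ by ring
      · simp only [B, Finset.sum_mul]
        refine (Finset.abs_sum_le_sum_abs _ _).trans (Finset.sum_le_sum fun a _ ↦
          (Finset.abs_sum_le_sum_abs _ _).trans (Finset.sum_le_sum fun b _ ↦ ?_))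
        rw [← Finset.sum_mul, abs_mul, mul_comm]
        have h1 : |u a * u b| ≤ ∑ a, u a ^ 2 := by
          have ha := Finset.single_le_sum (f := fun a ↦ u a ^ 2) (fun b _ ↦ sq_nonneg _)
            (Finset.mem_univ a)
          have hb := Finset.single_le_sum (f := fun a ↦ u a ^ 2) (fun b _ ↦ sq_nonneg _)
            (Finset.mem_univ b)
          rw [abs_le]
          constructor <;> nlinarith [sq_nonneg (u a + u b), sq_nonneg (u a - u b)]
        have h2 : |c (F a b) v| ≤ ∑ w, |c (F a b) w| :=
          Finset.single_le_sum (f := fun w ↦ |c (F a b) w|) (fun w _ ↦ abs_nonneg _)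
            (Finset.mem_univ v)
        gcongr
      · refine (hF y hy u).trans_eq ?_
        have h1 : ∀ a b, eval y (F a b) = ∑ w, (∏ t, y (w t)) * c (F a b) w := by
          intro a b
          conv_lhs => rw [hc (F a b) (hFhom a b)]
          simp [map_sum, map_prod, mul_comm]
        simp only [h1, Finset.mul_sum]
        symm
        rw [sum_sum_sum_comm]
        exact Finset.sum_congr rfl fun a _ ↦ Finset.sum_congr rfl fun b _ ↦
          Finset.sum_congr rfl fun σ _ ↦ by ring
  · have h1 : ∑ w : Fin N → Fin n × Fin n × Bool, (∏ i, pairForm (w i)) ^ 2 * C (A w a b) =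
        ∑ σ ∈ inj, (∑ l, pairForm l ^ 2) ^ (N - (K + 4)) *
          ∑ v, (∏ i, pairForm (v i) ^ 2) * C (c (F a b) v) := by
      simp only [A, map_sum, Finset.mul_sum]
      rw [Finset.sum_comm]
      refine Finset.sum_congr rfl fun σ hσ ↦ ?_
      have := sum_prod_mul_comp_embedding (fun l ↦ pairForm (n := n) l ^ 2)
        (fun v ↦ C (c (F a b) v)) (Finset.mem_filter.1 hσ).2
      simp only [Fintype.card_fin] at this
      rw [← Finset.mul_sum, ← this]
      simp [Finset.prod_pow]
    have h2 : ∑ v, (∏ i, pairForm (v i) ^ 2) * C (c (F a b) v) =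
        (∑ l, pairForm l ^ 2) ^ 4 * M a b := by
      rw [← hFsubst]
      conv_rhs => rw [hc (F a b) (hFhom a b)]
      simp [squareSubst, map_sum, map_prod, algebraMap_eq, mul_comm]
    have h3 : N - (K + 4) + 4 = T * 2 := by grind
    rw [h1, h2, Finset.sum_const, card_filter_injective, mul_pow, ← C_pow,
      Real.sq_sqrt (Nat.cast_nonneg _), ← mul_assoc, ← pow_add, h3, pow_mul, nsmul_eq_mul,
      map_natCast, mul_assoc]

open scoped MatrixOrder in
lemma Matrix.PosDef.exists_isUnit_transpose_mul_self {J : Type*} [Fintype J] [DecidableEq J]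
    {A : Matrix J J ℝ} (hA : A.PosDef) : ∃ B : Matrix J J ℝ, IsUnit B ∧ A = B.transpose * B := by
  have hsqrt := CFC.sqrt_mul_sqrt_self A hA.posSemidef.nonneg
  refine ⟨CFC.sqrt A, ?_, ?_⟩
  · exact isUnit_of_mul_isUnit_left (hsqrt ▸ hA.isUnit)
  · have := (Matrix.nonneg_iff_posSemidef.1 (CFC.sqrt_nonneg A)).isHermitian
    rw [← Matrix.conjTranspose_eq_transpose_of_trivial, this.eq, hsqrt]

/-- Up to a square factor, a positive definite matrix of forms of even degree is a sum of rank one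
matrices of forms generating all vectors of forms of the corresponding degree. -/
lemma exists_spanning_decomposition {n K : ℕ} {J : Type} [Fintype J] [DecidableEq J]
    (M : Matrix J J (MvPolynomial (Fin n) ℝ)) (hsymm : M.IsSymm)
    (hM : ∀ a b, (M a b).IsHomogeneous (2 * K))
    (hpos : ∀ p : Fin n → ℝ, p ≠ 0 → (M.map (eval p)).PosDef) :
    ∃ (N : ℕ) (t : MvPolynomial (Fin n) ℝ) (S : Type) (_ : Fintype S)
      (v : S → J → MvPolynomial (Fin n) ℝ),
      (∀ s a, (v s a).IsHomogeneous N) ∧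
      (∀ a b, t ^ 2 * M a b = ∑ s, v s a * v s b) ∧
      ∀ (w : Fin N → Fin n) (a : J),
        Pi.single a (∏ i, X (w i)) ∈ Submodule.span (MvPolynomial (Fin n) ℝ) (Set.range v) := by
  obtain ⟨N, t, A, hA, ht⟩ := exists_posDef_word_coeff M hsymm hM hpos
  choose B hBunit hB using fun w ↦ (hA w).exists_isUnit_transpose_mul_self
  refine ⟨N, t, (Fin N → Fin n × Fin n × Bool) × J, inferInstance,
    fun s a ↦ (∏ i, pairForm (s.1 i)) * C (B s.1 s.2 a), fun s a ↦ ?_, fun a b ↦ ?_,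
    fun w a ↦ ?_⟩
  · simpa using (IsHomogeneous.prod Finset.univ _ (fun _ ↦ 1)
      fun (i : Fin N) _ ↦ isHomogeneous_pairForm (s.1 i)).mul (isHomogeneous_C _ (B s.1 s.2 a))
  · rw [ht, Fintype.sum_prod_type]
    refine Finset.sum_congr rfl fun w _ ↦ ?_
    rw [hB w, Matrix.mul_apply, map_sum, Finset.mul_sum]
    refine Finset.sum_congr rfl fun s _ ↦ ?_
    simp only [Matrix.transpose_apply, C_mul]
    ring
  · let w' : Fin N → Fin n × Fin n × Bool := fun i ↦ (w i, w i, true)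
    have hinv : (B w')⁻¹ * B w' = 1 :=
      Matrix.nonsing_inv_mul _ ((Matrix.isUnit_iff_isUnit_det _).1 (hBunit w'))
    have h2 : ∀ i, (X i : MvPolynomial (Fin n) ℝ) = C (1 / 2) * pairForm (i, i, true) := by
      intro i
      have h : (C (1 / 2) : MvPolynomial (Fin n) ℝ) * 2 = 1 := by
        rw [show (2 : MvPolynomial (Fin n) ℝ) = C 2 from (map_ofNat C 2).symm, ← C_mul]
        norm_num
      simp only [pairForm, if_true]
      linear_combination -(X i : MvPolynomial (Fin n) ℝ) * h
    have h3 : (Pi.single a (∏ i, X (w i)) : J → MvPolynomial (Fin n) ℝ) =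
        ∑ s, (C ((1 / 2) ^ N * (B w')⁻¹ a s) : MvPolynomial (Fin n) ℝ) •
          (fun b ↦ (∏ i, pairForm (w' i)) * C (B w' s b) : J → MvPolynomial (Fin n) ℝ) := by
      funext b
      have h4 := congrFun (congrFun hinv a) b
      rw [Matrix.mul_apply] at h4
      have h5 : ∏ i, (X (w i) : MvPolynomial (Fin n) ℝ) =
          C ((1 / 2) ^ N) * ∏ i, pairForm (w' i) := by
        simp only [h2, Finset.prod_mul_distrib, Finset.prod_const, Finset.card_univ,
          Fintype.card_fin, C_pow, w']
      calc _ = (∏ i, X (w i)) * C ((1 : Matrix J J ℝ) a b) := by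
            rw [Pi.single_apply, Matrix.one_apply]
            simp only [eq_comm (a := b)]
            split_ifs <;> simp
        _ = _ := by
            rw [← h4, map_sum, Finset.mul_sum, Finset.sum_apply, h5]
            refine Finset.sum_congr rfl fun s _ ↦ ?_
            simp only [Pi.smul_apply, smul_eq_mul, C_mul]
            ring
    rw [h3]
    exact Submodule.sum_mem _ fun s _ ↦ Submodule.smul_mem _ _
      (Submodule.subset_span ⟨(w', s), rfl⟩)

/-! ### Reduction to constant degree -/

/-- The degree of a positive definite homogeneous matrix is even and bounds twice every twist. -/
lemma exists_twist_bound {n m : ℕ} (hn : n ≠ 0) (hm : 1 ≤ m) {α : Fin m → ℕ} {D : ℕ}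
    {Λ : Matrix (Fin m) (Fin m) (MvPolynomial (Fin n) ℝ)} (hΛ : IsMatHomog α D Λ)
    (hpd : ∀ p : Fin n → ℝ, p ≠ 0 → (Λ.map (eval p)).PosDef) :
    ∃ d, D = 2 * d ∧ ∀ i, α i ≤ d := by
  have : Nonempty (Fin n) := ⟨⟨0, Nat.pos_of_ne_zero hn⟩⟩
  have hdiag : ∀ p : Fin n → ℝ, p ≠ 0 → ∀ i, 0 < eval p (Λ i i) :=
    fun p hp i ↦ (hpd p hp).diag_pos
  have hle : ∀ i, α i + α i ≤ D := fun i ↦ by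
    by_contra! h
    have := hdiag 1 one_ne_zero i
    rw [(hΛ i i).2 h] at this
    simp at this
  have heven : Even (D - α ⟨0, hm⟩ - α ⟨0, hm⟩) := by
    rw [← Nat.not_odd_iff_even]
    intro hodd
    set i : Fin m := ⟨0, hm⟩
    obtain ⟨c, hc⟩ := (by simpa using (hΛ i i).1 :
      (Λ i i).IsHomogeneous (Fintype.card (Fin (D - α i - α i)))).exists_word_coeff
    have h1 := hdiag 1 one_ne_zero i
    have h2 := hdiag (-1) (neg_ne_zero.2 one_ne_zero) i
    rw [hc] at h1 h2
    simp only [map_sum, map_mul, eval_C, map_prod, eval_X, Pi.one_apply, Pi.neg_apply,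
      Finset.prod_const, Finset.card_univ, Fintype.card_fin, hodd.neg_one_pow, one_pow,
      mul_one, mul_neg, Finset.sum_neg_distrib] at h1 h2
    linarith
  obtain ⟨e, he⟩ := heven
  have h0 := hle ⟨0, hm⟩
  refine ⟨e + α ⟨0, hm⟩, by omega, fun i ↦ ?_⟩
  have := hle i
  omega

/-- The congruence of `Λ` by a family `β` with scaling `s`, corrected on the diagonal blocks by a
multiple of the Gram defect of `β`. -/
def blowup {A I : Type*} {W : I → Type*} [CommRing A] [DecidableEq I] [∀ i, DecidableEq (W i)]
    (Λ : Matrix I I A) (s t g : I → A) (β : (Σ i, W i) → A) :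
    Matrix (Σ i, W i) (Σ i, W i) A :=
  fun a b ↦ s a.1 * β a * (s b.1 * β b) * Λ a.1 b.1 +
    ((if a = b then t a.1 * g a.1 else 0) - (if a.1 = b.1 then t a.1 * (β a * β b) else 0))

section Blowup

variable {A I : Type*} {W : I → Type*} [CommRing A] [DecidableEq I] [∀ i, DecidableEq (W i)]

lemma map_blowup {B : Type*} [CommRing B] (φ : A →+* B) (Λ : Matrix I I A) (s t g : I → A)
    (β : (Σ i, W i) → A) :
    (blowup Λ s t g β).map φ =
      blowup (Λ.map φ) (fun i ↦ φ (s i)) (fun i ↦ φ (t i)) (fun i ↦ φ (g i)) (fun a ↦ φ (β a)) := by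
  ext a b
  simp [blowup, apply_ite φ]

lemma isSymm_blowup {Λ : Matrix I I A} (hΛ : Λ.IsSymm) (s t g : I → A) (β : (Σ i, W i) → A) :
    (blowup Λ s t g β).IsSymm := by
  refine Matrix.IsSymm.ext fun a b ↦ ?_
  simp only [blowup, hΛ.apply a.1 b.1, eq_comm (a := b), eq_comm (a := b.1)]
  congr 1
  · ring
  · congr 1
    · split_ifs with hab
      · rw [hab]
      · rfl
    · split_ifs with hab
      · rw [hab]; ring
      · rfl

variable [∀ i, Fintype (W i)]

lemma sum_sum_blowup_block (Λ : Matrix I I A) (s t g : I → A) (β : (Σ i, W i) → A)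
    (hg : ∀ i, ∑ f, β ⟨i, f⟩ ^ 2 = g i) (i j : I) :
    ∑ f, ∑ f', β ⟨i, f⟩ * β ⟨j, f'⟩ * blowup Λ s t g β ⟨i, f⟩ ⟨j, f'⟩ =
      s i * g i * (s j * g j) * Λ i j := by
  simp only [blowup, mul_add, mul_sub, Finset.sum_add_distrib, Finset.sum_sub_distrib]
  have h1 : ∑ f, ∑ f', β ⟨i, f⟩ * β ⟨j, f'⟩ * (s i * β ⟨i, f⟩ * (s j * β ⟨j, f'⟩) * Λ i j) =
      s i * g i * (s j * g j) * Λ i j := by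
    simp only [← hg, Finset.mul_sum, Finset.sum_mul]
    rw [Finset.sum_comm]
    exact Finset.sum_congr rfl fun f _ ↦ Finset.sum_congr rfl fun f' _ ↦ by ring
  rw [h1, add_eq_left, sub_eq_zero]
  by_cases hij : i = j
  · subst hij
    simp only [Sigma.mk.injEq, heq_eq_eq, true_and, mul_ite, mul_zero, Finset.sum_ite_eq,
      Finset.mem_univ, if_true]
    trans t i * g i * g i
    · nth_rw 3 [← hg]
      rw [Finset.mul_sum]
      exact Finset.sum_congr rfl fun f _ ↦ by ring
    · simp only [← hg, Finset.mul_sum, Finset.sum_mul]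
      exact Finset.sum_congr rfl fun f _ ↦ Finset.sum_congr rfl fun f' _ ↦ by ring
  · simp [hij]

variable [Fintype I]

lemma sum_sum_mul_blowup (Λ : Matrix I I A) (s t g : I → A) (β u : (Σ i, W i) → A) :
    ∑ a, ∑ b, u a * u b * blowup Λ s t g β a b =
      (∑ i, ∑ j, s i * (∑ f, β ⟨i, f⟩ * u ⟨i, f⟩) * (s j * ∑ f, β ⟨j, f⟩ * u ⟨j, f⟩) * Λ i j) +
        ∑ i, t i * (g i * ∑ f, u ⟨i, f⟩ ^ 2 - (∑ f, β ⟨i, f⟩ * u ⟨i, f⟩) ^ 2) := by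
  simp only [blowup, mul_add, mul_sub, Finset.sum_add_distrib, Finset.sum_sub_distrib]
  congr 1
  · simp only [Fintype.sum_sigma]
    refine Finset.sum_congr rfl fun i _ ↦ ?_
    rw [Finset.sum_comm]
    refine Finset.sum_congr rfl fun j _ ↦ ?_
    simp only [Finset.mul_sum, Finset.sum_mul]
    rw [Finset.sum_comm]
    exact Finset.sum_congr rfl fun f _ ↦ Finset.sum_congr rfl fun f' _ ↦ by ring
  · congr 1
    · simp only [mul_ite, mul_zero, Finset.sum_ite_eq, Finset.mem_univ, if_true,
        Fintype.sum_sigma, Finset.mul_sum]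
      exact Finset.sum_congr rfl fun i _ ↦ Finset.sum_congr rfl fun f _ ↦ by ring
    · simp only [Fintype.sum_sigma, mul_ite, mul_zero]
      refine Finset.sum_congr rfl fun i _ ↦ ?_
      rw [Finset.sum_comm, Finset.sum_eq_single i (by simp +contextual [eq_comm]) (by simp)]
      simp only [if_true, sq, Finset.mul_sum, Finset.sum_mul]
      exact Finset.sum_congr rfl fun f _ ↦ Finset.sum_congr rfl fun f' _ ↦ by ring

lemma posDef_blowup {Λ : Matrix I I ℝ} (hΛ : Λ.PosDef) {s t g : I → ℝ} {β : (Σ i, W i) → ℝ}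
    (hs : ∀ i, 0 < s i) (ht : ∀ i, 0 < t i) (hg : ∀ i, ∑ f, β ⟨i, f⟩ ^ 2 = g i)
    (hg0 : ∀ i, 0 < g i) : (blowup Λ s t g β).PosDef := by
  refine .of_dotProduct_mulVec_pos ?_ fun u hu ↦ ?_
  · exact isSymm_blowup hΛ.isHermitian s t g β
  · have h := sum_sum_mul_blowup Λ s t g β u
    have h' : star u ⬝ᵥ (blowup Λ s t g β).mulVec u =
        ∑ a, ∑ b, u a * u b * blowup Λ s t g β a b := by
      simp only [dotProduct, Matrix.mulVec, Finset.mul_sum, Pi.star_apply, star_trivial]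
      exact Finset.sum_congr rfl fun a _ ↦ Finset.sum_congr rfl fun b _ ↦ by ring
    rw [h', h]
    set U : I → ℝ := fun i ↦ ∑ f, β ⟨i, f⟩ * u ⟨i, f⟩
    have hdefect : ∀ i, 0 ≤ t i * (g i * ∑ f, u ⟨i, f⟩ ^ 2 - U i ^ 2) := fun i ↦
      mul_nonneg (ht i).le (sub_nonneg.2 (hg i ▸ Finset.sum_mul_sq_le_sq_mul_sq _ _ _))
    have hform : ∑ i, ∑ j, s i * U i * (s j * U j) * Λ i j =
        star (fun i ↦ s i * U i) ⬝ᵥ Λ.mulVec (fun i ↦ s i * U i) := by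
      simp only [dotProduct, Matrix.mulVec, Finset.mul_sum, Pi.star_apply, star_trivial]
      exact Finset.sum_congr rfl fun a _ ↦ Finset.sum_congr rfl fun b _ ↦ by ring
    by_cases hU0 : U = 0
    · obtain ⟨⟨i, f⟩, hif⟩ := Function.ne_iff.1 hu
      have hif : u ⟨i, f⟩ ≠ 0 := hif
      have hform0 : ∑ i, ∑ j, s i * U i * (s j * U j) * Λ i j = 0 := by simp [hU0]
      rw [hform0, zero_add]
      refine Finset.sum_pos' (fun i _ ↦ hdefect i) ⟨i, Finset.mem_univ i, ?_⟩
      have hi : 0 < ∑ f, u ⟨i, f⟩ ^ 2 :=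
        Finset.sum_pos' (fun _ _ ↦ sq_nonneg _) ⟨f, Finset.mem_univ f, by positivity⟩
      have := ht i
      have := hg0 i
      change 0 < t i * (g i * ∑ f, u ⟨i, f⟩ ^ 2 - U i ^ 2)
      rw [hU0, Pi.zero_apply, zero_pow two_ne_zero, sub_zero]
      positivity
    · refine add_pos_of_pos_of_nonneg ?_ (Finset.sum_nonneg fun i _ ↦ hdefect i)
      refine hform ▸ hΛ.dotProduct_mulVec_pos fun h0 ↦ hU0 (funext fun i ↦ ?_)
      exact (mul_eq_zero.1 (congrFun h0 i)).resolve_left (hs i).ne'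

end Blowup

/-- The products of `d - α i` variables, placed in block `i`. -/
noncomputable def wordMonomial {n m : ℕ} (α : Fin m → ℕ) (d : ℕ)
    (a : Σ i : Fin m, (Fin (d - α i) → Fin n)) : MvPolynomial (Fin n) ℝ :=
  ∏ t, X (a.2 t)

/-- Contraction of a vector indexed by words to a vector indexed by blocks. -/
noncomputable def wordContraction {n m : ℕ} (α : Fin m → ℕ) (d : ℕ) :
    ((Σ i : Fin m, (Fin (d - α i) → Fin n)) → MvPolynomial (Fin n) ℝ) →ₗ[MvPolynomial (Fin n) ℝ]
      (Fin m → MvPolynomial (Fin n) ℝ) :=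
  LinearMap.pi fun i ↦ ∑ f : Fin (d - α i) → Fin n, wordMonomial α d ⟨i, f⟩ •
    LinearMap.proj (⟨i, f⟩ : Σ i : Fin m, (Fin (d - α i) → Fin n))

lemma wordContraction_apply {n m : ℕ} (α : Fin m → ℕ) (d : ℕ)
    (v : (Σ i : Fin m, (Fin (d - α i) → Fin n)) → MvPolynomial (Fin n) ℝ) (i : Fin m) :
    wordContraction α d v i = ∑ f, wordMonomial α d ⟨i, f⟩ * v ⟨i, f⟩ := by
  simp [wordContraction]

lemma wordContraction_single {n m : ℕ} (α : Fin m → ℕ) (d : ℕ)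
    (a : Σ i : Fin m, (Fin (d - α i) → Fin n)) (p : MvPolynomial (Fin n) ℝ) :
    wordContraction α d (Pi.single a p) = Pi.single a.1 (wordMonomial α d a * p) := by
  obtain ⟨i, f⟩ := a
  funext j
  rw [wordContraction_apply]
  by_cases hij : j = i
  · subst hij
    rw [Pi.single_eq_same, Finset.sum_eq_single f]
    · rw [Pi.single_eq_same]
    · intro f' _ hf
      rw [Pi.single_eq_of_ne (by simpa using hf), mul_zero]
    · simp
  · rw [Pi.single_eq_of_ne hij]
    refine Finset.sum_eq_zero fun f' _ ↦ ?_
    rw [Pi.single_eq_of_ne (by simp [hij]), mul_zero]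

lemma isHomogeneous_wordMonomial {n m : ℕ} (α : Fin m → ℕ) (d : ℕ)
    (a : Σ i : Fin m, (Fin (d - α i) → Fin n)) :
    (wordMonomial α d a).IsHomogeneous (d - α a.1) := by
  simpa [wordMonomial] using IsHomogeneous.prod Finset.univ
    (fun t ↦ (X (a.2 t) : MvPolynomial (Fin n) ℝ)) (fun _ ↦ 1) fun t _ ↦ isHomogeneous_X ℝ (a.2 t)

lemma sum_wordMonomial_sq {n m : ℕ} (α : Fin m → ℕ) (d : ℕ) (i : Fin m) :
    ∑ f, (wordMonomial α d ⟨i, f⟩ : MvPolynomial (Fin n) ℝ) ^ 2 =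
      (∑ j, X j ^ 2) ^ (d - α i) := by
  simp [wordMonomial, Fintype.sum_pow, Finset.prod_pow]

/-- The decomposition of a positive definite matrix of degree `2 * d` whose twists are at most `d`. -/
lemma exists_homogeneous_decomposition {n m : ℕ} {α : Fin m → ℕ} {d : ℕ} (hα : ∀ i, α i ≤ d)
    {Λ : Matrix (Fin m) (Fin m) (MvPolynomial (Fin n) ℝ)} (hsymm : Λ.IsSymm)
    (hΛ : IsMatHomog α (2 * d) Λ)
    (hpd : ∀ p : Fin n → ℝ, p ≠ 0 → (Λ.map (eval p)).PosDef) :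
    ∃ (k : ℕ) (t : MvPolynomial (Fin n) ℝ) (S : Type) (_ : Fintype S)
      (v : S → Fin m → MvPolynomial (Fin n) ℝ),
      (∀ s, IsVHomog α k (v s)) ∧
      (∀ i j, t ^ 2 * Λ i j = ∑ s, v s i * v s j) ∧
      ∀ k' u, k ≤ k' → IsVHomog α k' u →
        u ∈ Submodule.span (MvPolynomial (Fin n) ℝ) (Set.range v) := by
  let h : MvPolynomial (Fin n) ℝ := ∑ j, X j ^ 2
  have hh : h.IsHomogeneous 2 := IsHomogeneous.sum _ _ _ fun j _ ↦ isHomogeneous_X_pow j 2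
  let M := blowup Λ (fun i ↦ h ^ α i) (fun i ↦ h ^ (d + α i)) (fun i ↦ h ^ (d - α i))
    (wordMonomial α d)
  have hMhom : ∀ a b, (M a b).IsHomogeneous (2 * (2 * d)) := fun a b ↦ by
    have ha := hα a.1
    have hb := hα b.1
    have hβa := isHomogeneous_wordMonomial α d a
    have hβb := isHomogeneous_wordMonomial α d b
    refine IsHomogeneous.add ?_ (IsHomogeneous.sub ?_ ?_)
    · have hdeg : 2 * α a.1 + (d - α a.1) + (2 * α b.1 + (d - α b.1)) +
          (2 * d - α a.1 - α b.1) = 2 * (2 * d) := by omega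
      exact hdeg ▸ (((hh.pow (α a.1)).mul hβa).mul ((hh.pow (α b.1)).mul hβb)).mul
        (hΛ a.1 b.1).1
    · split_ifs
      · have hdeg : 2 * (d + α a.1) + 2 * (d - α a.1) = 2 * (2 * d) := by omega
        exact hdeg ▸ (hh.pow (d + α a.1)).mul (hh.pow (d - α a.1))
      · exact isHomogeneous_zero _ _ _
    · split_ifs with hab
      · have hdeg : 2 * (d + α a.1) + (d - α a.1 + (d - α b.1)) = 2 * (2 * d) := by
          rw [← hab]
          omega
        exact hdeg ▸ (hh.pow (d + α a.1)).mul (hβa.mul hβb)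
      · exact isHomogeneous_zero _ _ _
  have hMpos : ∀ p : Fin n → ℝ, p ≠ 0 → (M.map (eval p)).PosDef := fun p hp ↦ by
    have hhp : 0 < eval p h := by
      obtain ⟨j, hj⟩ := Function.ne_iff.1 hp
      have hj : p j ≠ 0 := hj
      simp only [h, map_sum, map_pow, eval_X]
      exact Finset.sum_pos' (fun _ _ ↦ sq_nonneg _) ⟨j, Finset.mem_univ j, by positivity⟩
    rw [map_blowup]
    refine posDef_blowup (hpd p hp) (fun i ↦ ?_) (fun i ↦ ?_) (fun i ↦ ?_) fun i ↦ ?_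
    · simpa using pow_pos hhp _
    · simpa using pow_pos hhp _
    · simpa [h] using congrArg (eval p) (sum_wordMonomial_sq α d i)
    · simpa using pow_pos hhp _
  obtain ⟨N, t, S, _, v, hv, hvM, hspan⟩ :=
    exists_spanning_decomposition M (isSymm_blowup hsymm _ _ _ _) hMhom hMpos
  refine ⟨d + N, t * h ^ d, S, inferInstance, fun s ↦ wordContraction α d (v s),
    fun s i ↦ ⟨?_, fun hlt ↦ ?_⟩, fun i j ↦ ?_, fun k' u hk' hu ↦ ?_⟩
  · simp only [wordContraction_apply]
    refine IsHomogeneous.sum _ _ _ fun f _ ↦ ?_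
    convert (isHomogeneous_wordMonomial α d ⟨i, f⟩).mul (hv s ⟨i, f⟩) using 1
    have := hα i
    grind
  · have := hα i
    omega
  · have hblock := sum_sum_blowup_block Λ (fun i ↦ h ^ α i) (fun i ↦ h ^ (d + α i))
      (fun i ↦ h ^ (d - α i)) (wordMonomial α d) (sum_wordMonomial_sq α d) i j
    simp only [← pow_add, Nat.add_sub_cancel' (hα i), Nat.add_sub_cancel' (hα j)] at hblock
    calc (t * h ^ d) ^ 2 * Λ i j = t ^ 2 * (h ^ d * h ^ d * Λ i j) := by ring
      _ = ∑ f, ∑ f', ∑ s, wordMonomial α d ⟨i, f⟩ * v s ⟨i, f⟩ *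
          (wordMonomial α d ⟨j, f'⟩ * v s ⟨j, f'⟩) := by
        rw [← pow_add, ← hblock, Finset.mul_sum]
        refine Finset.sum_congr rfl fun f _ ↦ ?_
        rw [Finset.mul_sum]
        refine Finset.sum_congr rfl fun f' _ ↦ ?_
        rw [mul_left_comm, hvM, Finset.mul_sum]
        exact Finset.sum_congr rfl fun s _ ↦ by ring
      _ = _ := by
        rw [← sum_sum_sum_comm]
        simp only [wordContraction_apply, Finset.sum_mul_sum]
  · set P := Submodule.span (MvPolynomial (Fin n) ℝ)
      (Set.range fun s ↦ wordContraction α d (v s))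
    have hmap : P = (Submodule.span _ (Set.range v)).map (wordContraction α d) := by
      rw [Submodule.map_span, ← Set.range_comp]
      rfl
    rw [← Finset.univ_sum_single u]
    refine Submodule.sum_mem _ fun i _ ↦ ?_
    have hcard : Fintype.card (Fin (k' - (d + N)) ⊕ Fin N ⊕ Fin (d - α i)) = k' - α i := by
      simp only [Fintype.card_sum, Fintype.card_fin]
      have := hα i
      omega
    have hui := (hcard ▸ (hu i).1).mem_span_prod_X
    suffices hle : Submodule.span ℝ (Set.range fun w : Fin (k' - (d + N)) ⊕ Fin N ⊕ Fin (d - α i) →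
        Fin n ↦ ∏ t, (X (w t) : MvPolynomial (Fin n) ℝ)) ≤
        (P.restrictScalars ℝ).comap (LinearMap.single ℝ (fun _ ↦ MvPolynomial (Fin n) ℝ) i) from
      hle hui
    rw [Submodule.span_le]
    rintro _ ⟨w, rfl⟩
    have hmem := Submodule.smul_mem P (∏ t, X (w (Sum.inl t))) (hmap ▸ Submodule.mem_map_of_mem
      (hspan (fun t ↦ w (Sum.inr (Sum.inl t))) ⟨i, fun t ↦ w (Sum.inr (Sum.inr t))⟩))
    rw [wordContraction_single, ← Pi.single_smul, smul_eq_mul] at hmem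
    simpa [wordMonomial, Fintype.prod_sum_type, mul_comm, mul_left_comm, mul_assoc] using hmem

/-- **Corollary.** Let `Λ` be a symmetric homogeneous `m×m` matrix over `R = ℝ[x₁,…,xₙ]`
which is positive definite. Then there are `k ∈ ℕ`, a sum of squares `q ∈ R` and vectors
`v₁,…,v_r ∈ R^m`, homogeneous of degree `k`, such that `q·Λ = v₁·v₁ᵀ + … + v_r·v_rᵀ` and
`v₁,…,v_r` generate the submodule `R^m_{≥k}` of `R^m`. -/
theorem statement16 {n m : ℕ} (hm : 1 ≤ m) (α : Fin m → ℕ) (D : ℕ)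
    (Λ : Matrix (Fin m) (Fin m) (MvPolynomial (Fin n) ℝ)) (hsymm : Λ.IsSymm)
    (hΛ : IsMatHomog α D Λ)
    (hpd : ∀ p : Fin n → ℝ, p ≠ 0 → (Λ.map (eval p)).PosDef) :
    ∃ (k : ℕ) (q : MvPolynomial (Fin n) ℝ) (r : ℕ)
      (v : Fin r → (Fin m → MvPolynomial (Fin n) ℝ)),
      IsSOS q ∧ (∀ i, IsVHomog α k (v i)) ∧
      q • Λ = ∑ i, Matrix.vecMulVec (v i) (v i) ∧
      Submodule.span (MvPolynomial (Fin n) ℝ) (Set.range v) =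
        Submodule.span (MvPolynomial (Fin n) ℝ)
          {u : Fin m → MvPolynomial (Fin n) ℝ | ∃ k', k ≤ k' ∧ IsVHomog α k' u} := by
  rcases eq_or_ne n 0 with rfl | hn
  · have hzero : ∀ k, Finset.univ.sup α + 1 ≤ k → ∀ u : Fin m → MvPolynomial (Fin 0) ℝ,
        IsVHomog α k u → u = 0 := fun k hk u hu ↦ by
      funext i
      by_contra hi
      have h0 := (isHomogeneous_of_isEmpty (Fin 0) ℝ (u i)).inj_right (hu i).1 hi
      have := Finset.le_sup (f := α) (Finset.mem_univ i)
      omega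
    refine ⟨Finset.univ.sup α + 1, 0, 0, Fin.elim0, ⟨0, Fin.elim0, by simp⟩, fun i ↦ i.elim0,
      by simp, ?_⟩
    rw [Set.range_eq_empty, Submodule.span_empty]
    refine (Submodule.span_eq_bot.2 ?_).symm
    rintro u ⟨k', hk', hu⟩
    exact hzero k' hk' u hu
  · obtain ⟨d, rfl, hα⟩ := exists_twist_bound hn hm hΛ hpd
    obtain ⟨k, t, S, _, v, hv, hdecomp, hspan⟩ :=
      exists_homogeneous_decomposition hα hsymm hΛ hpd
    let e := Fintype.equivFin S
    refine ⟨k, t ^ 2, Fintype.card S, fun r ↦ v (e.symm r), ⟨1, fun _ ↦ t, by simp⟩,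
      fun r ↦ hv _, ?_, le_antisymm ?_ ?_⟩
    · ext1 i j
      rw [Equiv.sum_comp e.symm fun s ↦ Matrix.vecMulVec (v s) (v s), Matrix.sum_apply]
      simpa [Matrix.vecMulVec_apply] using hdecomp i j
    · refine Submodule.span_mono ?_
      rintro _ ⟨r, rfl⟩
      exact ⟨k, le_rfl, hv _⟩
    · rw [Submodule.span_le]
      rintro u ⟨k', hk', hu⟩
      have hrange : Set.range (fun r ↦ v (e.symm r)) = Set.range v :=
        e.symm.surjective.range_comp v
      rw [hrange]
      exact hspan k' u hk' hu
end
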